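/- For every positive real β and every integer k ≥ 3, there exist constants C and n₀ such that the following holds. For every integer n ≥ n₀, if m ≥ C·n^{1−1/(k−1)}, then the number of m-element subsets of {1,…,n} that contain no k-term arithmetic progression is at most binom(⌊βn⌋, m). -/

import Mathlib

/-! ### Averages over finite types -/

/-- Average of a real function over a finite type. -/
noncomputable def av {X : Type*} (f : X → ℝ) : ℝ := (∑ᶠ x, f x) / (Nat.card X : ℝ)

open Classical in
/-- Indicator of a proposition. -/
noncomputable def ind (p : Prop) : ℝ := if p then 1 else 0

lemma ind_true {p : Prop} (h : p) : ind p = 1 := by simp [ind, h]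
lemma ind_false {p : Prop} (h : ¬ p) : ind p = 0 := by simp [ind, h]
lemma ind_nonneg (p : Prop) : 0 ≤ ind p := by unfold ind; split_ifs <;> norm_num
lemma ind_le_one (p : Prop) : ind p ≤ 1 := by unfold ind; split_ifs <;> norm_num
lemma ind_mono {p q : Prop} (h : p → q) : ind p ≤ ind q := by
  by_cases hp : p
  · rw [ind_true hp, ind_true (h hp)]
  · rw [ind_false hp]; exact ind_nonneg q

section av
variable {X Y : Type*}

lemma av_eq [Fintype X] (f : X → ℝ) : av f = (∑ x, f x) / (Fintype.card X : ℝ) := by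
  rw [av, finsum_eq_sum_of_fintype, Nat.card_eq_fintype_card]

lemma av_mono [Finite X] {f g : X → ℝ} (h : ∀ x, f x ≤ g x) : av f ≤ av g := by
  cases nonempty_fintype X
  rw [av_eq, av_eq]
  gcongr
  exact h _

lemma av_congr {f g : X → ℝ} (h : ∀ x, f x = g x) : av f = av g := by
  rw [funext h]

lemma av_add [Finite X] (f g : X → ℝ) : av (fun x => f x + g x) = av f + av g := by
  cases nonempty_fintype X
  rw [av_eq, av_eq, av_eq, Finset.sum_add_distrib, add_div]

lemma av_sub [Finite X] (f g : X → ℝ) : av (fun x => f x - g x) = av f - av g := by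
  cases nonempty_fintype X
  rw [av_eq, av_eq, av_eq, Finset.sum_sub_distrib, sub_div]

lemma av_mul_left [Finite X] (c : ℝ) (f : X → ℝ) : av (fun x => c * f x) = c * av f := by
  cases nonempty_fintype X
  rw [av_eq, av_eq, ← Finset.mul_sum, mul_div_assoc]

lemma av_const [Finite X] [Nonempty X] (c : ℝ) : av (fun _ : X => c) = c := by
  cases nonempty_fintype X
  rw [av_eq]
  simp

lemma av_nonneg [Finite X] {f : X → ℝ} (h : ∀ x, 0 ≤ f x) : 0 ≤ av f := by
  cases nonempty_fintype X
  rw [av_eq]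
  exact div_nonneg (Finset.sum_nonneg fun x _ => h x) (by positivity)

lemma av_le [Finite X] [Nonempty X] {f : X → ℝ} {c : ℝ} (h : ∀ x, f x ≤ c) : av f ≤ c :=
  (av_mono h).trans (av_const c).le

lemma le_av [Finite X] [Nonempty X] {f : X → ℝ} {c : ℝ} (h : ∀ x, c ≤ f x) : c ≤ av f :=
  (av_const c).ge.trans (av_mono h)

lemma exists_le_of_le_av [Finite X] [Nonempty X] {f : X → ℝ} {c : ℝ} (h : c ≤ av f) :
    ∃ x, c ≤ f x := by
  cases nonempty_fintype X
  by_contra! hc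
  rw [av_eq, le_div_iff₀ (by positivity)] at h
  have := Finset.sum_lt_sum_of_nonempty (s := (Finset.univ : Finset X)) Finset.univ_nonempty
    (fun x _ => hc x)
  simp only [Finset.sum_const, Finset.card_univ, nsmul_eq_mul] at this
  linarith

lemma av_prod [Finite X] [Finite Y] (f : X × Y → ℝ) :
    av f = av (fun x => av (fun y => f (x, y))) := by
  cases nonempty_fintype X
  cases nonempty_fintype Y
  simp only [av_eq]
  rw [Fintype.sum_prod_type, ← Finset.sum_div, Fintype.card_prod, Nat.cast_mul, div_div, mul_comm]

lemma av_comm [Finite X] [Finite Y] (f : X → Y → ℝ) :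
    av (fun x => av (fun y => f x y)) = av (fun y => av (fun x => f x y)) := by
  cases nonempty_fintype X
  cases nonempty_fintype Y
  simp only [av_eq]
  rw [← Finset.sum_div, ← Finset.sum_div, Finset.sum_comm, div_div, div_div, mul_comm]

lemma av_equiv (e : X ≃ Y) (f : Y → ℝ) : av (fun x => f (e x)) = av f := by
  rw [av, av, finsum_comp_equiv e, Nat.card_congr e]

lemma av_sum_elim {ι κ α : Type*} [Finite ι] [Finite κ] [Finite α] (f : (ι ⊕ κ → α) → ℝ) :
    av f = av (fun x : ι → α => av (fun z : κ → α => f (Sum.elim x z))) := by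
  rw [← av_equiv (Equiv.sumArrowEquivProdArrow ι κ α).symm f, av_prod]
  rfl

/-- If one value is much less than the average, then another is somewhat larger. -/
lemma exists_increment [Finite X] {f : X → ℝ} {δ η : ℝ} (h : δ ≤ av f) {x₀ : X}
    (hx : f x₀ < δ - η) : ∃ x, δ + η / (Nat.card X : ℝ) ≤ f x := by
  classical
  cases nonempty_fintype X
  by_contra! hc
  have : Nonempty X := ⟨x₀⟩
  rw [Nat.card_eq_fintype_card] at hc
  have hN : (0 : ℝ) < Fintype.card X := by positivity
  rw [av_eq, le_div_iff₀ hN] at h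
  have h1 : ∑ x, f x ≤ ∑ x, ((δ + η / (Fintype.card X : ℝ)) - if x = x₀ then η else 0) := by
    refine Finset.sum_le_sum fun x _ => ?_
    split_ifs with hxx
    · subst hxx
      have := hc x
      by_cases hη : 0 ≤ η
      · have : 0 ≤ η / (Fintype.card X : ℝ) := by positivity
        linarith
      · push Not at hη
        have h1 : η ≤ η / (Fintype.card X : ℝ) := by
          rw [le_div_iff₀ hN]
          have : (1 : ℝ) ≤ Fintype.card X := by exact_mod_cast Fintype.card_pos
          nlinarith
        have h2 : η / (Fintype.card X : ℝ) < 0 := div_neg_of_neg_of_pos hη hN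
        linarith
    · linarith [hc x]
  have h2 : ∑ x, f x < ∑ x, ((δ + η / (Fintype.card X : ℝ)) - if x = x₀ then η else 0) := by
    refine Finset.sum_lt_sum (fun x _ => ?_) ⟨x₀, Finset.mem_univ _, ?_⟩
    · split_ifs with hxx
      · subst hxx
        have := hc x
        by_cases hη : 0 ≤ η
        · have : 0 ≤ η / (Fintype.card X : ℝ) := by positivity
          linarith
        · push Not at hη
          have h1 : η ≤ η / (Fintype.card X : ℝ) := by
            rw [le_div_iff₀ hN]
            have : (1 : ℝ) ≤ Fintype.card X := by exact_mod_cast Fintype.card_pos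
            nlinarith
          linarith
      · linarith [hc x]
    · simp only [if_true]
      by_cases hη : 0 ≤ η
      · have : 0 ≤ η / (Fintype.card X : ℝ) := by positivity
        linarith
      · push Not at hη
        have h1 : η ≤ η / (Fintype.card X : ℝ) := by
          rw [le_div_iff₀ hN]
          have : (1 : ℝ) ≤ Fintype.card X := by exact_mod_cast Fintype.card_pos
          nlinarith
        linarith [hc x₀]
  rw [Finset.sum_sub_distrib] at h2
  simp only [Finset.sum_const, Finset.card_univ, nsmul_eq_mul, Finset.sum_ite_eq',
    Finset.mem_univ, if_true] at h2
  have h3 : (Fintype.card X : ℝ) * (δ + η / (Fintype.card X : ℝ)) = Fintype.card X * δ + η := by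
    field_simp
  linarith

/-- Markov-type inequality. -/
lemma markov_half [Finite X] [Nonempty X] {f : X → ℝ} {δ : ℝ} (hf : ∀ x, f x ≤ 1)
    (h : δ ≤ av f) (hδ : 0 ≤ δ) : δ / 2 ≤ av (fun x => ind (δ / 2 ≤ f x)) := by
  have h1 : av f ≤ av (fun x => ind (δ / 2 ≤ f x) + δ / 2) := by
    refine av_mono fun x => ?_
    by_cases hx : δ / 2 ≤ f x
    · rw [ind_true hx]; linarith [hf x]
    · rw [ind_false hx]; linarith
  rw [av_add, av_const] at h1
  linarith

/-- Pigeonhole: if almost surely-ish one of finitely many events happens, one has large measure. -/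
lemma exists_of_av_exists [Finite X] [Finite Y] [Nonempty Y] {P : Y → X → Prop} {δ : ℝ}
    (h : δ ≤ av (fun x => ind (∃ y, P y x))) :
    ∃ y, δ / (Nat.card Y : ℝ) ≤ av (fun x => ind (P y x)) := by
  cases nonempty_fintype X
  cases nonempty_fintype Y
  by_contra! hc
  rw [Nat.card_eq_fintype_card] at hc
  have h1 : av (fun x => ind (∃ y, P y x)) ≤ ∑ y, av (fun x => ind (P y x)) := by
    simp only [av_eq]
    rw [← Finset.sum_div, Finset.sum_comm]
    gcongr with x
    by_cases hx : ∃ y, P y x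
    · obtain ⟨y, hy⟩ := hx
      calc ind (∃ y, P y x) ≤ 1 := ind_le_one _
        _ = ind (P y x) := (ind_true hy).symm
        _ ≤ _ := Finset.single_le_sum (f := fun y => ind (P y x)) (fun _ _ => ind_nonneg _)
            (Finset.mem_univ y)
    · rw [ind_false hx]; exact Finset.sum_nonneg fun _ _ => ind_nonneg _
  have h2 := Finset.sum_lt_sum_of_nonempty (s := (Finset.univ : Finset Y)) Finset.univ_nonempty
    (fun y _ => hc y)
  simp only [Finset.sum_const, Finset.card_univ, nsmul_eq_mul] at h2
  have hN : (0 : ℝ) < Fintype.card Y := by positivity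
  rw [mul_div_cancel₀ _ hN.ne'] at h2
  linarith

end av

/-! ### Combinatorial subspaces -/

open Combinatorics

section subspaces
variable {η ζ α ι κ : Type}

/-- Composition of combinatorial subspaces. -/
def subComp (V : Subspace η α ι) (W : Subspace ζ α η) : Subspace ζ α ι where
  idxFun i := (V.idxFun i).elim Sum.inl W.idxFun
  proper e := by
    obtain ⟨j, hj⟩ := W.proper e
    obtain ⟨i, hi⟩ := V.proper j
    exact ⟨i, by simp [hi, hj]⟩

lemma subComp_apply (V : Subspace η α ι) (W : Subspace ζ α η) (x : ζ → α) :
    subComp V W x = V (W x) := by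
  funext i
  simp only [Subspace.coe_apply, subComp]
  cases h : V.idxFun i <;> simp [Subspace.coe_apply]

/-- Image of a line under a subspace. -/
def lineComp (V : Subspace η α ι) (l : Line α η) : Line α ι where
  idxFun i := (V.idxFun i).elim some l.idxFun
  proper := by
    obtain ⟨j, hj⟩ := l.proper
    obtain ⟨i, hi⟩ := V.proper j
    exact ⟨i, by simp [hi, hj]⟩

lemma lineComp_apply (V : Subspace η α ι) (l : Line α η) (a : α) :
    lineComp V l a = V (l a) := by
  funext i
  simp only [Subspace.coe_apply, lineComp, Line.coe_apply]
  cases h : V.idxFun i <;> simp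

/-- Extend a subspace by constants on the left. -/
def subInr (x : κ → α) (V : Subspace η α ι) : Subspace η α (κ ⊕ ι) where
  idxFun := Sum.elim (fun i => Sum.inl (x i)) V.idxFun
  proper e := by
    obtain ⟨i, hi⟩ := V.proper e
    exact ⟨Sum.inr i, by simp [hi]⟩

lemma subInr_apply (x : κ → α) (V : Subspace η α ι) (y : η → α) :
    subInr x V y = Sum.elim x (V y) := by
  funext i
  cases i <;> simp [Subspace.coe_apply, subInr]

/-- Extend a subspace by constants on the right. -/
def subInl (V : Subspace η α ι) (x : κ → α) : Subspace η α (ι ⊕ κ) where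
  idxFun := Sum.elim V.idxFun (fun i => Sum.inl (x i))
  proper e := by
    obtain ⟨i, hi⟩ := V.proper e
    exact ⟨Sum.inl i, by simp [hi]⟩

lemma subInl_apply (V : Subspace η α ι) (x : κ → α) (y : η → α) :
    subInl V x y = Sum.elim (V y) x := by
  funext i
  cases i <;> simp [Subspace.coe_apply, subInl]

/-- The identity subspace. -/
def subId (ι α : Type) : Subspace ι α ι where
  idxFun := Sum.inr
  proper e := ⟨e, rfl⟩

lemma subId_apply (x : ι → α) : subId ι α x = x := rfl

/-- A subspace in the first variables and a line in the others. -/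
def subLine (V : Subspace η α ι) (l : Line α κ) : Subspace (Option η) α (ι ⊕ κ) where
  idxFun := Sum.elim (fun i => (V.idxFun i).elim Sum.inl (fun e => Sum.inr (some e)))
    (fun j => (l.idxFun j).elim (Sum.inr none) Sum.inl)
  proper e := by
    cases e with
    | none =>
      obtain ⟨j, hj⟩ := l.proper
      exact ⟨Sum.inr j, by simp [hj]⟩
    | some e =>
      obtain ⟨i, hi⟩ := V.proper e
      exact ⟨Sum.inl i, by simp [hi]⟩

lemma subLine_apply (V : Subspace η α ι) (l : Line α κ) (x : Option η → α) :
    subLine V l x = Sum.elim (V (fun e => x (some e))) (l (x none)) := by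
  funext i
  cases i with
  | inl i =>
    simp only [Subspace.coe_apply, subLine, Sum.elim_inl]
    cases h : V.idxFun i <;> simp
  | inr j =>
    simp only [Subspace.coe_apply, subLine, Sum.elim_inr, Line.coe_apply]
    cases h : l.idxFun j <;> simp

/-- Add a letter to the alphabet. -/
def subLift (V : Subspace η α ι) : Subspace η (Option α) ι where
  idxFun i := (V.idxFun i).elim (fun a => Sum.inl (some a)) Sum.inr
  proper e := by
    obtain ⟨i, hi⟩ := V.proper e
    exact ⟨i, by simp [hi]⟩

lemma subLift_some (V : Subspace η α ι) (x : η → α) :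
    subLift V (fun e => some (x e)) = fun i => some (V x i) := by
  funext i
  simp only [Subspace.coe_apply, subLift]
  cases h : V.idxFun i <;> simp

lemma subLift_getD (V : Subspace η α ι) (x : η → Option α) (a : α) (i : ι) :
    (subLift V x i).getD a = V (fun e => (x e).getD a) i := by
  simp only [Subspace.coe_apply, subLift]
  cases h : V.idxFun i <;> simp

lemma sub_injective (V : Subspace η α ι) : Function.Injective (V : (η → α) → ι → α) := by
  intro x y h
  funext e
  obtain ⟨i, hi⟩ := V.proper e
  have := congrFun h i
  rwa [Subspace.apply_inr hi, Subspace.apply_inr hi] at this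

end subspaces

/-- Density Hales-Jewett for an alphabet. -/
def DHJ (α : Type) : Prop :=
  ∀ δ : ℝ, 0 < δ → ∃ (ι : Type) (_ : Finite ι), ∀ A : Set (ι → α),
    δ ≤ av (fun x => ind (x ∈ A)) → ∃ l : Line α ι, ∀ a, l a ∈ A

/-- Multidimensional density Hales-Jewett. -/
def MDHJ (α : Type) : Prop :=
  ∀ (η : Type) [Finite η], ∀ δ : ℝ, 0 < δ → ∃ (ι : Type) (_ : Finite ι), ∀ A : Set (ι → α),
    δ ≤ av (fun x => ind (x ∈ A)) → ∃ V : Subspace η α ι, ∀ x, V x ∈ A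

lemma exists_of_av_ind_pos {X : Type*} [Finite X] {A : Set X} (h : 0 < av (fun x => ind (x ∈ A))) :
    ∃ x, x ∈ A := by
  by_contra! hc
  have : av (fun x => ind (x ∈ A)) = 0 := by
    rw [av_congr (g := fun _ => (0 : ℝ) * 0) (fun x => by rw [ind_false (hc x)]; ring), av_mul_left,
      zero_mul]
  linarith

theorem mdhj_of_dhj {α : Type} [Finite α] [Nonempty α] (h : DHJ α) : MDHJ α := by
  intro η hη
  induction η using Finite.induction_empty_option with
  | of_equiv e ih =>
    intro δ hδ
    obtain ⟨ι, hι, H⟩ := ih δ hδ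
    refine ⟨ι, hι, fun A hA => ?_⟩
    obtain ⟨V, hV⟩ := H A hA
    refine ⟨subComp V ⟨fun i => Sum.inr (e i), fun j => ⟨e.symm j, by simp⟩⟩, fun x => ?_⟩
    rw [subComp_apply]
    exact hV _
  | h_empty =>
    intro δ hδ
    refine ⟨Empty, inferInstance, fun A hA => ?_⟩
    obtain ⟨x, hx⟩ := exists_of_av_ind_pos (hδ.trans_le hA)
    refine ⟨⟨fun i => i.elim, fun e => nomatch e⟩, fun y => ?_⟩
    convert hx
  | h_option ih =>
    rename_i η
    intro δ hδ
    obtain ⟨κ, hκ, H1⟩ := h (δ / 2) (by positivity)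
    have hpos : (0 : ℝ) < Nat.card (κ → Option α) := by exact_mod_cast Nat.card_pos
    obtain ⟨ι, hι, H2⟩ := ih (δ / 2 / Nat.card (κ → Option α)) (by positivity)
    refine ⟨ι ⊕ κ, inferInstance, fun A hA => ?_⟩
    rw [av_sum_elim] at hA
    have h3 := markov_half (fun x => av_le (fun z => ind_le_one _)) hA hδ.le
    have h4 : δ / 2 ≤ av (fun x : ι → α => ind (∃ w : κ → Option α, ∃ l : Line α κ, l.idxFun = w ∧
        ∀ a, Sum.elim x (l a) ∈ A)) := by
      refine h3.trans (av_mono fun x => ind_mono fun hx => ?_)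
      obtain ⟨l, hl⟩ := H1 {z | Sum.elim x z ∈ A} hx
      exact ⟨l.idxFun, l, rfl, hl⟩
    obtain ⟨w, hw⟩ := exists_of_av_exists h4
    obtain ⟨V, hV⟩ := H2 {x | ∃ l : Line α κ, l.idxFun = w ∧ ∀ a, Sum.elim x (l a) ∈ A} hw
    obtain ⟨l, hl, -⟩ := hV (Classical.arbitrary _)
    refine ⟨subLine V l, fun x => ?_⟩
    rw [subLine_apply]
    obtain ⟨l', hl', h'⟩ := hV (fun e => x (some e))
    obtain rfl : l' = l := Line.ext (hl'.trans hl.symm)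
    exact h' _

open Combinatorics

/-! ### Density increment to obtain uniform fibres -/

/-- For large dimension, every set of density `δ` admits a nonempty family of `κ`-dimensional
subspaces such that each point is hit with probability at least `δ - η`. -/
theorem uniform_fibres (β : Type) [Finite β] [Nonempty β] (κ : Type) [Finite κ] (η : ℝ)
    (hη : 0 < η) (t : ℕ) :
    ∃ (ι : Type) (_ : Finite ι), ∀ (δ : ℝ), 1 < δ + t * (η / Nat.card (κ → β)) →
      ∀ A : Set (ι → β), δ ≤ av (fun x => ind (x ∈ A)) →
      ∃ (Z : Type) (_ : Finite Z) (_ : Nonempty Z) (V : Z → Subspace κ β ι),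
        ∀ x : κ → β, δ - η ≤ av (fun z => ind (V z x ∈ A)) := by
  induction t with
  | zero =>
    refine ⟨Empty, inferInstance, fun δ h1 A hA => ?_⟩
    exfalso
    have : av (fun x => ind (x ∈ A)) ≤ 1 := av_le fun x => ind_le_one _
    simp at h1
    linarith
  | succ t ih =>
    obtain ⟨ι, hι, H⟩ := ih
    refine ⟨κ ⊕ ι, inferInstance, fun δ h1 A hA => ?_⟩
    rw [av_sum_elim] at hA
    by_cases hall : ∀ x : κ → β, δ - η ≤ av (fun z : ι → β => ind (Sum.elim x z ∈ A))
    · refine ⟨ι → β, inferInstance, inferInstance, fun z => subInl (subId κ β) z, fun x => ?_⟩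
      simpa only [subInl_apply, subId_apply] using hall x
    · push Not at hall
      obtain ⟨x₀, hx₀⟩ := hall
      obtain ⟨x, hx⟩ := exists_increment hA hx₀
      have hpos : (0 : ℝ) < η / Nat.card (κ → β) := by
        have : (0 : ℝ) < Nat.card (κ → β) := by exact_mod_cast Nat.card_pos
        positivity
      obtain ⟨Z, h2, h3, V, hV⟩ := H (δ + η / Nat.card (κ → β)) (by push_cast at h1; linarith)
        {z | Sum.elim x z ∈ A} hx
      refine ⟨Z, h2, h3, fun z => subInr x (V z), fun y => ?_⟩
      simp only [subInr_apply]
      have := hV y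
      simp only [Set.mem_setOf_eq] at this
      linarith

theorem uniform_fibres' (β : Type) [Finite β] [Nonempty β] (κ : Type) [Finite κ] (η δ : ℝ)
    (hη : 0 < η) :
    ∃ (ι : Type) (_ : Finite ι),
      ∀ A : Set (ι → β), δ ≤ av (fun x => ind (x ∈ A)) →
      ∃ (Z : Type) (_ : Finite Z) (_ : Nonempty Z) (V : Z → Subspace κ β ι),
        ∀ x : κ → β, δ - η ≤ av (fun z => ind (V z x ∈ A)) := by
  have hpos : (0 : ℝ) < η / Nat.card (κ → β) := by
    have : (0 : ℝ) < Nat.card (κ → β) := by exact_mod_cast Nat.card_pos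
    positivity
  obtain ⟨t, ht⟩ := exists_nat_gt ((1 - δ) / (η / Nat.card (κ → β)))
  rw [div_lt_iff₀ hpos] at ht
  obtain ⟨ι, hι, H⟩ := uniform_fibres β κ η hη t
  exact ⟨ι, hι, H δ (by linarith)⟩

/-! ### Insensitive sets -/

section insens
variable {α : Type}

/-- `D` does not distinguish the letters `none` and `some a`. -/
def Insens {ι : Type} (a : α) (D : Set (ι → Option α)) : Prop :=
  ∀ x y : ι → Option α, (∀ i, (x i).getD a = (y i).getD a) → (x ∈ D → y ∈ D)

lemma Insens.compl {ι : Type} {a : α} {D : Set (ι → Option α)} (h : Insens a D) :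
    Insens a Dᶜ := fun x y hxy hx hy => hx (h y x (fun i => (hxy i).symm) hy)

lemma Insens.univ {ι : Type} {a : α} : Insens a (Set.univ : Set (ι → Option α)) :=
  fun _ _ _ _ => trivial

lemma Insens.comp {ι η : Type} {a : α} {D : Set (ι → Option α)} (h : Insens a D)
    (V : Subspace η (Option α) ι) : Insens a {x | V x ∈ D} := by
  intro x y hxy hx
  refine h _ _ (fun i => ?_) hx
  simp only [Subspace.coe_apply]
  cases hi : V.idxFun i with
  | inl b => simp
  | inr e => simpa using hxy e

variable [Finite α] [Nonempty α]

/-- A dense insensitive set contains large subspaces. -/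
theorem insens_subspace (h : MDHJ α) (m : Type) [Finite m] (δ : ℝ) (hδ : 0 < δ) :
    ∃ (ι : Type) (_ : Finite ι), ∀ (a : α) (D : Set (ι → Option α)), Insens a D →
      δ ≤ av (fun x => ind (x ∈ D)) → ∃ V : Subspace m (Option α) ι, ∀ x, V x ∈ D := by
  obtain ⟨κ, hκ, H1⟩ := h m (δ / 2) (by positivity)
  obtain ⟨ι, hι, H2⟩ := uniform_fibres' (Option α) κ (δ / 2) δ (by positivity)
  refine ⟨ι, hι, fun a D hD hdens => ?_⟩
  obtain ⟨Z, hZ, hZ', V, hV⟩ := H2 D hdens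
  have h1 : δ / 2 ≤ av (fun x : κ → α => av (fun z => ind (V z (fun e => some (x e)) ∈ D))) :=
    le_av fun x => by linarith [hV (fun e => some (x e))]
  rw [av_comm] at h1
  obtain ⟨z, hz⟩ := exists_le_of_le_av h1
  obtain ⟨W, hW⟩ := H1 {x | V z (fun e => some (x e)) ∈ D} hz
  refine ⟨subComp (V z) (subLift W), fun x => ?_⟩
  rw [subComp_apply]
  have h2 := hW (fun e => (x e).getD a)
  simp only [Set.mem_setOf_eq, ← subLift_some] at h2
  refine (hD.comp (V z)) _ _ (fun i => ?_) h2
  rw [subLift_getD, subLift_getD]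
  simp

/-- Covering lemma, iterated version. -/
theorem insens_cover_aux (a : α) (m κ : Type) [Finite m] [Finite κ] (ρ : ℝ) (hρ : 0 < ρ)
    (hκ : ∀ D : Set (κ → Option α), Insens a D →
      ρ / 2 ≤ av (fun x => ind (x ∈ D)) → ∃ V : Subspace m (Option α) κ, ∀ x, V x ∈ D)
    (hρ1 : ρ ≤ 1) (t : ℕ) :
    ∃ (ι : Type) (_ : Finite ι), ∀ (D : Set (ι → Option α)), Insens a D →
      ∀ f : (ι → Option α) → ℝ, (∀ x, f x ≤ 1) →
        (∀ V : Subspace m (Option α) ι, av (fun x => f (V x)) ≤ 0) →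
        av (fun x => f x * ind (x ∈ D)) ≤
          ρ + (1 - ρ / 2 / Nat.card (κ → Option α)) ^ t * av (fun x => ind (x ∈ D)) := by
  have hNpos : (0 : ℝ) < Nat.card (κ → Option α) := by exact_mod_cast Nat.card_pos
  have hN1 : (1 : ℝ) ≤ Nat.card (κ → Option α) := by exact_mod_cast Nat.card_pos
  set c : ℝ := ρ / 2 / Nat.card (κ → Option α) with hc
  have hc0 : 0 < c := by positivity
  have hc1 : c ≤ 1 := by
    rw [hc, div_le_one hNpos]; linarith
  induction t with
  | zero =>
    refine ⟨Empty, inferInstance, fun D hD f hf _ => ?_⟩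
    have : av (fun x => f x * ind (x ∈ D)) ≤ av (fun x => ind (x ∈ D)) :=
      av_mono fun x => by nlinarith [hf x, ind_nonneg (x ∈ D)]
    simp only [pow_zero, one_mul]
    linarith
  | succ t ih =>
    obtain ⟨ι, hι, H⟩ := ih
    refine ⟨κ ⊕ ι, inferInstance, fun D hD f hf hfV => ?_⟩
    by_cases hsmall : av (fun x => ind (x ∈ D)) ≤ ρ
    · have h1 : av (fun x => f x * ind (x ∈ D)) ≤ av (fun x => ind (x ∈ D)) :=
        av_mono fun x => by nlinarith [hf x, ind_nonneg (x ∈ D)]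
      have h2 : 0 ≤ (1 - c) ^ (t + 1) * av (fun x => ind (x ∈ D)) :=
        mul_nonneg (pow_nonneg (by linarith) _) (av_nonneg fun x => ind_nonneg _)
      linarith
    push Not at hsmall
    -- fibre sets
    let Dz : (ι → Option α) → Set (κ → Option α) := fun z => {x | Sum.elim x z ∈ D}
    have hDz : ∀ z, Insens a (Dz z) := by
      intro z x y hxy hx
      refine hD _ _ (fun i => ?_) hx
      cases i with
      | inl i => simpa using hxy i
      | inr i => simp
    have hDz' : ∀ z z' : ι → Option α, (∀ i, (z i).getD a = (z' i).getD a) → Dz z = Dz z' := by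
      intro z z' hzz
      ext x
      constructor
      · intro hx
        refine hD _ _ (fun i => ?_) hx
        cases i with
        | inl i => simp
        | inr i => simpa using hzz i
      · intro hx
        refine hD _ _ (fun i => ?_) hx
        cases i with
        | inl i => simp
        | inr i => simpa using (hzz i).symm
    -- choice of subspaces
    have hF : ∃ F : Set (κ → Option α) → Set (κ → Option α), ∀ B, Insens a B →
        (ρ / 2 ≤ av (fun x => ind (x ∈ B)) →
          ∃ V : Subspace m (Option α) κ, F B = Set.range V ∧ F B ⊆ B) ∧
        (¬ ρ / 2 ≤ av (fun x => ind (x ∈ B)) → F B = ∅) := by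
      have : ∀ B : Set (κ → Option α), ∃ S : Set (κ → Option α), Insens a B →
        (ρ / 2 ≤ av (fun x => ind (x ∈ B)) →
          ∃ V : Subspace m (Option α) κ, S = Set.range V ∧ S ⊆ B) ∧
        (¬ ρ / 2 ≤ av (fun x => ind (x ∈ B)) → S = ∅) := by
        intro B
        by_cases hB : Insens a B
        · by_cases hd : ρ / 2 ≤ av (fun x => ind (x ∈ B))
          · obtain ⟨V, hV⟩ := hκ B hB hd
            refine ⟨Set.range V, fun _ => ⟨fun _ => ⟨V, rfl, ?_⟩, fun h => absurd hd h⟩⟩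
            rintro _ ⟨x, rfl⟩
            exact hV x
          · exact ⟨∅, fun _ => ⟨fun h => absurd h hd, fun _ => rfl⟩⟩
        · exact ⟨∅, fun h => absurd h hB⟩
      choose F hF using this
      exact ⟨F, hF⟩
    obtain ⟨F, hF⟩ := hF
    -- the remaining set
    let D' : (κ → Option α) → Set (ι → Option α) := fun x => {z | x ∈ Dz z ∧ x ∉ F (Dz z)}
    have hD' : ∀ x, Insens a (D' x) := by
      intro x z z' hzz hz
      simp only [D', Set.mem_setOf_eq] at hz ⊢
      rwa [← hDz' z z' hzz]
    have hsplit : ∀ x z, ind (Sum.elim x z ∈ D) = ind (x ∈ F (Dz z)) + ind (z ∈ D' x) := by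
      intro x z
      have hsub : x ∈ F (Dz z) → Sum.elim x z ∈ D := by
        intro hx
        by_cases hd : ρ / 2 ≤ av (fun x => ind (x ∈ Dz z))
        · obtain ⟨V, -, h2⟩ := (hF _ (hDz z)).1 hd
          exact h2 hx
        · rw [(hF _ (hDz z)).2 hd] at hx
          exact absurd hx (Set.notMem_empty _)
      by_cases h1 : x ∈ F (Dz z)
      · rw [ind_true (hsub h1), ind_true h1, ind_false (fun h : z ∈ D' x => h.2 h1)]; ring
      · by_cases h2 : Sum.elim x z ∈ D
        · rw [ind_true h2, ind_false h1, ind_true (show z ∈ D' x from ⟨h2, h1⟩)]; ring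
        · rw [ind_false h2, ind_false h1, ind_false (fun h : z ∈ D' x => h2 h.1)]; ring
    have hIH : ∀ x, av (fun z => f (Sum.elim x z) * ind (z ∈ D' x)) ≤
        ρ + (1 - c) ^ t * av (fun z => ind (z ∈ D' x)) := by
      intro x
      refine H (D' x) (hD' x) (fun z => f (Sum.elim x z)) (fun z => hf _) (fun V => ?_)
      have := hfV (subInr x V)
      simpa only [subInr_apply] using this
    -- removed part contributes at most zero
    have hrem : ∀ z, av (fun x => f (Sum.elim x z) * ind (x ∈ F (Dz z))) ≤ 0 := by
      intro z
      by_cases hd : ρ / 2 ≤ av (fun x => ind (x ∈ Dz z))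
      · obtain ⟨V, h1, -⟩ := (hF _ (hDz z)).1 hd
        have h2 := hfV (subInl V z)
        simp only [subInl_apply] at h2
        classical
        cases nonempty_fintype (κ → Option α)
        cases nonempty_fintype (m → Option α)
        rw [av_eq] at h2 ⊢
        have h3 : ∑ x, f (Sum.elim (V x) z) ≤ 0 := by
          by_contra hlt
          push Not at hlt
          have : 0 < (Fintype.card (m → Option α) : ℝ) := by positivity
          have := div_pos hlt this
          linarith
        refine div_nonpos_of_nonpos_of_nonneg ?_ (by positivity)
        rw [← Finset.sum_image (f := fun y => f (Sum.elim y z)) (s := Finset.univ)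
          (g := V) (fun x _ y _ h => sub_injective V h)] at h3
        refine le_trans (le_of_eq ?_) h3
        rw [Finset.sum_subset (Finset.subset_univ (Finset.univ.image V)) (f :=
          fun y => f (Sum.elim y z) * ind (y ∈ F (Dz z)))
          (fun y _ hy => by
            rw [ind_false, mul_zero]
            rw [h1]
            rintro ⟨x, rfl⟩
            exact hy (Finset.mem_image_of_mem _ (Finset.mem_univ _)))|>.symm]
        refine Finset.sum_congr rfl fun y hy => ?_
        rw [ind_true, mul_one]
        rw [h1]
        obtain ⟨x, -, rfl⟩ := Finset.mem_image.1 hy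
        exact ⟨x, rfl⟩
      · rw [(hF _ (hDz z)).2 hd]
        refine av_le fun x => ?_
        rw [ind_false (Set.notMem_empty _), mul_zero]
    -- removed part is large
    have hbig : c ≤ av (fun z => av (fun x => ind (x ∈ F (Dz z)))) := by
      rw [av_sum_elim, av_comm] at hsmall
      have h1 := markov_half (fun z => av_le (fun x => ind_le_one _)) hsmall.le hρ.le
      have h2 : av (fun z : ι → Option α => (1 / (Nat.card (κ → Option α) : ℝ)) *
          ind (ρ / 2 ≤ av (fun x => ind (Sum.elim x z ∈ D)))) ≤
          av (fun z => av (fun x => ind (x ∈ F (Dz z)))) := by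
        refine av_mono fun z => ?_
        by_cases hd : ρ / 2 ≤ av (fun x => ind (Sum.elim x z ∈ D))
        · rw [ind_true hd]
          obtain ⟨V, h1, -⟩ := (hF _ (hDz z)).1 hd
          cases nonempty_fintype (κ → Option α)
          rw [av_eq, Nat.card_eq_fintype_card, mul_one]
          gcongr
          calc (1 : ℝ) = ind (V (fun _ => none) ∈ F (Dz z)) := by
                rw [ind_true]; rw [h1]; exact ⟨_, rfl⟩
            _ ≤ _ := Finset.single_le_sum (f := fun x => ind (x ∈ F (Dz z)))
                (fun _ _ => ind_nonneg _) (Finset.mem_univ _)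
        · rw [ind_false hd, mul_zero]
          exact av_nonneg fun _ => ind_nonneg _
      rw [av_mul_left] at h2
      refine le_trans ?_ h2
      rw [hc, div_eq_mul_one_div (ρ / 2), mul_comm]
      gcongr
    have hdens : av (fun x => ind (x ∈ D)) = av (fun z => av (fun x => ind (x ∈ F (Dz z)))) +
        av (fun x => av (fun z => ind (z ∈ D' x))) := by
      rw [av_sum_elim, av_comm (fun z x => ind (x ∈ F (Dz z))), ← av_add]
      refine av_congr fun x => ?_
      rw [← av_add]
      exact av_congr fun z => hsplit x z
    have hd1 : av (fun x => ind (x ∈ D)) ≤ 1 := av_le fun _ => ind_le_one _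
    have hf1 : av (fun x => f x * ind (x ∈ D)) =
        av (fun z => av (fun x => f (Sum.elim x z) * ind (x ∈ F (Dz z)))) +
        av (fun x => av (fun z => f (Sum.elim x z) * ind (z ∈ D' x))) := by
      rw [av_sum_elim, av_comm (fun z x => f (Sum.elim x z) * ind (x ∈ F (Dz z))), ← av_add]
      refine av_congr fun x => ?_
      rw [← av_add]
      refine av_congr fun z => ?_
      rw [hsplit x z, mul_add]
    have hf2 : av (fun z => av (fun x => f (Sum.elim x z) * ind (x ∈ F (Dz z)))) ≤ 0 :=
      av_le hrem
    have hf3 := av_mono hIH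
    rw [av_add, av_const, av_mul_left] at hf3
    have hf4 : av (fun x => av (fun z => ind (z ∈ D' x))) ≤ (1 - c) * av (fun x => ind (x ∈ D)) := by
      nlinarith
    have hf5 : (1 - c) ^ t * av (fun x => av (fun z => ind (z ∈ D' x))) ≤
        (1 - c) ^ t * ((1 - c) * av (fun x => ind (x ∈ D))) :=
      mul_le_mul_of_nonneg_left hf4 (pow_nonneg (by linarith) _)
    rw [pow_succ, mul_assoc]
    linarith

/-- Covering lemma for one insensitive set. -/
theorem insens_cover (h : MDHJ α) (a : α) (m : Type) [Finite m] (ρ : ℝ) (hρ : 0 < ρ) :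
    ∃ (ι : Type) (_ : Finite ι), ∀ (D : Set (ι → Option α)), Insens a D →
      ∀ f : (ι → Option α) → ℝ, (∀ x, f x ≤ 1) →
        (∀ V : Subspace m (Option α) ι, av (fun x => f (V x)) ≤ 0) →
        av (fun x => f x * ind (x ∈ D)) ≤ ρ := by
  set ρ' := min (ρ / 2) 1 with hρ'
  have h0 : 0 < ρ' := lt_min (by positivity) one_pos
  obtain ⟨κ, hκ, H⟩ := insens_subspace h m (ρ' / 2) (by positivity)
  have hNpos : (0 : ℝ) < Nat.card (κ → Option α) := by exact_mod_cast Nat.card_pos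
  have hN1 : (1 : ℝ) ≤ Nat.card (κ → Option α) := by exact_mod_cast Nat.card_pos
  have hc0 : 0 < ρ' / 2 / Nat.card (κ → Option α) := by positivity
  have hρ1 : ρ' ≤ 1 := min_le_right _ _
  have hc1 : ρ' / 2 / Nat.card (κ → Option α) ≤ 1 := by
    rw [div_le_one hNpos]; linarith
  obtain ⟨t, ht⟩ := exists_pow_lt_of_lt_one (show 0 < ρ / 2 by positivity)
    (show 1 - ρ' / 2 / Nat.card (κ → Option α) < 1 by linarith)
  obtain ⟨ι, hι, H'⟩ := insens_cover_aux a m κ ρ' h0 (H a) hρ1 t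
  refine ⟨ι, hι, fun D hD f hf hfV => (H' D hD f hf hfV).trans ?_⟩
  have hd1 : av (fun x => ind (x ∈ D)) ≤ 1 := av_le fun _ => ind_le_one _
  have hd0 : 0 ≤ av (fun x => ind (x ∈ D)) := av_nonneg fun _ => ind_nonneg _
  have h3 : ρ' ≤ ρ / 2 := min_le_left _ _
  have h4 : 0 ≤ (1 - ρ' / 2 / Nat.card (κ → Option α)) ^ t := pow_nonneg (by linarith) _
  nlinarith

/-- Covering lemma for the complement of an intersection of insensitive sets. -/
theorem insens_cover_inter (h : MDHJ α) (L : List α) :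
    ∀ (m : Type) [Finite m] (ρ : ℝ), 0 < ρ →
    ∃ (ι : Type) (_ : Finite ι), ∀ (D : α → Set (ι → Option α)), (∀ a, Insens a (D a)) →
      ∀ f : (ι → Option α) → ℝ, (∀ x, f x ≤ 1) →
        (∀ V : Subspace m (Option α) ι, av (fun x => f (V x)) ≤ 0) →
        av f ≤ ρ ∧ av (fun x => f x * (1 - ind (∀ a ∈ L, x ∈ D a))) ≤ ρ := by
  induction L with
  | nil =>
    intro m hm ρ hρ
    refine ⟨m, hm, fun D hD f hf hfV => ⟨?_, ?_⟩⟩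
    · have := hfV (subId m (Option α))
      simp only [subId_apply] at this
      exact this.trans hρ.le
    · refine av_le fun x => ?_
      rw [ind_true (by simp)]
      simpa using hρ.le
  | cons a L ih =>
    intro m hm ρ hρ
    obtain ⟨m₁, hm₁, H1⟩ := insens_cover h a m (ρ / 4) (by positivity)
    obtain ⟨ι, hι, H2⟩ := ih m₁ (ρ / 4) (by positivity)
    refine ⟨ι, hι, fun D hD f hf hfV => ?_⟩
    have key : ∀ E : Set (ι → Option α), Insens a E → ∀ V : Subspace m₁ (Option α) ι,
        av (fun x => f (V x) * ind (V x ∈ E) - ρ / 4) ≤ 0 := by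
      intro E hE V
      have := H1 {x | V x ∈ E} (hE.comp V) (fun x => f (V x)) (fun x => hf _) (fun W => by
        have := hfV (subComp V W)
        simpa only [subComp_apply] using this)
      rw [av_sub, av_const]
      simp only [Set.mem_setOf_eq] at this
      linarith
    have hle : ∀ (E : Set (ι → Option α)) x, f x * ind (x ∈ E) - ρ / 4 ≤ 1 := by
      intro E x
      have := ind_nonneg (x ∈ E)
      have := ind_le_one (x ∈ E)
      nlinarith [hf x]
    have g1 := (H2 D hD (fun x => f x * ind (x ∈ (Set.univ : Set (ι → Option α))) - ρ / 4)
      (hle _) (key _ Insens.univ)).1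
    have g2 := (H2 D hD (fun x => f x * ind (x ∈ (D a)ᶜ) - ρ / 4) (hle _) (key _ (hD a).compl)).1
    have g3 := (H2 D hD (fun x => f x * ind (x ∈ D a) - ρ / 4) (hle _) (key _ (hD a))).2
    rw [av_sub, av_const] at g1 g2
    constructor
    · have : av f = av (fun x => f x * ind (x ∈ (Set.univ : Set (ι → Option α)))) :=
        av_congr fun x => by rw [ind_true (Set.mem_univ x), mul_one]
      linarith
    · have e1 : av (fun x => f x * (1 - ind (∀ b ∈ a :: L, x ∈ D b))) ≤
          av (fun x => (f x * ind (x ∈ (D a)ᶜ)) +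
            (((f x * ind (x ∈ D a) - ρ / 4) * (1 - ind (∀ b ∈ L, x ∈ D b))) + ρ / 4)) := by
        refine av_mono fun x => ?_
        have p0 := ind_nonneg (∀ b ∈ L, x ∈ D b)
        have p1 := ind_le_one (∀ b ∈ L, x ∈ D b)
        by_cases hx : x ∈ D a
        · have e2 : ind (∀ b ∈ a :: L, x ∈ D b) = ind (∀ b ∈ L, x ∈ D b) := by
            congr 1
            simp [hx]
          rw [e2, ind_true hx, ind_false (fun h : x ∈ (D a)ᶜ => h hx)]
          nlinarith
        · have e2 : ind (∀ b ∈ a :: L, x ∈ D b) = 0 := ind_false (by simp [hx])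
          rw [e2, ind_false hx, ind_true (show x ∈ (D a)ᶜ from hx)]
          nlinarith
      rw [av_add, av_add, av_const] at e1
      linarith

end insens

/-! ### The avoiding-subspace dichotomy -/

open Combinatorics

section QLemma
variable {α : Type}

/-- Substitute `a` for the constant letter `none` and at the extra coordinate. -/
def wFun {κ ι : Type} (U : Subspace κ (Option α) ι) (a : Option α) (s : κ → Option α) :
    Option ι → Option α :=
  fun o => o.elim a (fun j => (U.idxFun j).elim (fun b => b.elim a some) s)

/-- The subspace obtained from `wFun`. -/
def wSub {κ ι m : Type} (U : Subspace κ (Option α) ι) (a : Option α)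
    (W : Subspace m (Option α) κ) : Subspace m (Option α) (Option ι) where
  idxFun o := o.elim (Sum.inl a) (fun j => (U.idxFun j).elim (fun b => Sum.inl (b.elim a some))
    W.idxFun)
  proper e := by
    obtain ⟨j, hj⟩ := W.proper e
    obtain ⟨i, hi⟩ := U.proper j
    exact ⟨some i, by simp [hi, hj]⟩

lemma wSub_apply {κ ι m : Type} (U : Subspace κ (Option α) ι) (a : Option α)
    (W : Subspace m (Option α) κ) (u : m → Option α) : wSub U a W u = wFun U a (W u) := by
  funext o
  cases o with
  | none => simp [Subspace.coe_apply, wSub, wFun]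
  | some j =>
    simp only [Subspace.coe_apply, wSub, wFun, Option.elim_some]
    cases h : U.idxFun j <;> simp [Subspace.coe_apply]

/-- The `α`-subspace with one more dimension. -/
def wOpt {κ ι M : Type} (U : Subspace κ (Option α) ι) (W : Subspace M α κ) :
    Subspace (Option M) α (Option ι) where
  idxFun o := o.elim (Sum.inr none) (fun j => (U.idxFun j).elim
    (fun b => b.elim (Sum.inr none) Sum.inl)
    (fun e => (W.idxFun e).elim Sum.inl (fun f => Sum.inr (some f))))
  proper e := by
    cases e with
    | none => exact ⟨none, rfl⟩
    | some e =>
      obtain ⟨j, hj⟩ := W.proper e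
      obtain ⟨i, hi⟩ := U.proper j
      exact ⟨some i, by simp [hi, hj]⟩

lemma wOpt_apply {κ ι M : Type} (U : Subspace κ (Option α) ι) (W : Subspace M α κ)
    (v : Option M → Option α) :
    subLift (wOpt U W) v = wFun U (v none) (subLift W (fun e => v (some e))) := by
  funext o
  cases o with
  | none => simp [Subspace.coe_apply, wOpt, wFun, subLift]
  | some j =>
    simp only [Subspace.coe_apply, wOpt, wFun, Option.elim_some, subLift]
    cases h : U.idxFun j with
    | inl b => cases b <;> simp
    | inr e => cases h' : W.idxFun e <;> simp [h', Subspace.coe_apply]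

lemma wFun_none {κ ι : Type} (U : Subspace κ (Option α) ι) (s : κ → Option α) :
    wFun U none s = fun o => o.elim none (U s) := by
  funext o
  cases o with
  | none => rfl
  | some j =>
    simp only [wFun, Option.elim_some, Subspace.coe_apply]
    cases h : U.idxFun j with
    | inl b => cases b <;> simp
    | inr e => simp

theorem avoid_dichotomy [Finite α] [Nonempty α] (m : Type) [Finite m] (M : Type) [Finite M] :
    ∀ (I : Type) [Finite I], ∃ (ι : Type) (_ : Finite ι), Nonempty (Subspace m (Option α) ι) ∧
      ∀ G : I → Set (ι → Option α), (∃ i, ∃ U : Subspace m (Option α) ι, ∀ u, U u ∈ G i) ∨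
        (∃ V : Subspace M α ι, ∀ i, ∀ v : M → Option α, (∃ e, v e = none) →
          subLift V v ∉ G i) := by
  rename_i hα hne hm hM
  induction M using Finite.induction_empty_option with
  | of_equiv e ih =>
    intro I hI
    obtain ⟨ι, hι, hN, H⟩ := ih I
    refine ⟨ι, hι, hN, fun G => ?_⟩
    rcases H G with h | ⟨V, hV⟩
    · exact Or.inl h
    · refine Or.inr ⟨subComp V ⟨fun i => Sum.inr (e i), fun j => ⟨e.symm j, by simp⟩⟩, ?_⟩
      rintro i v ⟨f, hf⟩
      have := hV i (fun j => v (e j)) ⟨e.symm f, by simp [hf]⟩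
      convert this using 2
      funext j
      simp only [subLift, subComp, Subspace.coe_apply]
      cases h : V.idxFun j <;> simp
  | h_empty =>
    intro I hI
    refine ⟨m, hm, ⟨subId m _⟩, fun G => ?_⟩
    obtain ⟨a⟩ := hne
    refine Or.inr ⟨⟨fun _ => Sum.inl a, fun e => e.elim⟩, ?_⟩
    rintro i v ⟨e, _⟩
    exact e.elim
  | h_option ih =>
    rename_i M hM
    intro I hI
    obtain ⟨κ, hκ, ⟨S⟩, H⟩ := ih (I × α)
    obtain ⟨ι, hι, H2⟩ := Subspace.exists_mono_in_high_dimension (Option α) (I → Prop) κ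
    have hf : Finite ι := @Finite.of_fintype _ hι
    refine ⟨Option ι, inferInstance, ?_, fun G => ?_⟩
    · obtain ⟨U, -⟩ := H2 (fun _ _ => True)
      exact ⟨wSub U none S⟩
    obtain ⟨U, col, hcol⟩ := H2 (fun s i => (fun o : Option ι => o.elim none s) ∈ G i)
    have hcol' : ∀ s i, wFun U none s ∈ G i ↔ col i := by
      intro s i
      rw [wFun_none, ← congrFun (hcol s) i]
    by_cases hgood : ∃ i, col i
    · obtain ⟨i, hi⟩ := hgood
      refine Or.inl ⟨i, wSub U none S, fun u => ?_⟩
      rw [wSub_apply, hcol']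
      exact hi
    · push Not at hgood
      rcases H (fun p => {s | wFun U (some p.2) s ∈ G p.1}) with ⟨⟨i, a⟩, W, hW⟩ | ⟨V, hV⟩
      · refine Or.inl ⟨i, wSub U (some a) W, fun u => ?_⟩
        rw [wSub_apply]
        exact hW u
      · refine Or.inr ⟨wOpt U V, ?_⟩
        rintro i v ⟨e, he⟩
        rw [wOpt_apply]
        cases hv : v none with
        | none => rw [hcol']; exact hgood i
        | some a =>
          refine hV (i, a) (fun e => v (some e)) ?_
          cases e with
          | none => rw [hv] at he; cases he
          | some e => exact ⟨e, he⟩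

end QLemma

/-! ### Density Hales-Jewett: the induction step -/

open Combinatorics

section DHJStep
variable {α : Type}

/-- Replace all occurrences of `none` by `a`. -/
def fill {ι : Type} (a : α) (x : ι → Option α) : ι → Option α := fun i => some ((x i).getD a)

/-- The line in alphabet `Option α` whose wildcard set is `x = none`. -/
def optLine {ι : Type} (x : ι → Option α) (h : ∃ i, x i = none) : Line (Option α) ι where
  idxFun i := (x i).map some
  proper := by obtain ⟨i, hi⟩ := h; exact ⟨i, by simp [hi]⟩

lemma optLine_none {ι : Type} (x : ι → Option α) (h : ∃ i, x i = none) :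
    optLine x h none = x := by
  funext i
  simp only [Line.coe_apply, optLine]
  cases x i <;> simp

lemma optLine_some {ι : Type} (x : ι → Option α) (h : ∃ i, x i = none) (a : α) :
    optLine x h (some a) = fill a x := by
  funext i
  simp only [Line.coe_apply, optLine, fill]
  cases x i <;> simp

theorem dhj_step [Finite α] [Nonempty α] (h : DHJ α) : DHJ (Option α) := by
  have hM : MDHJ α := mdhj_of_dhj h
  by_contra hcon
  unfold DHJ at hcon
  push Not at hcon
  obtain ⟨δ0, hδ0, hcon⟩ := hcon
  set S : Set ℝ := {δ | ∀ (ι : Type) (_ : Finite ι), ∃ A : Set (ι → Option α),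
    δ ≤ av (fun x => ind (x ∈ A)) ∧ ∀ l : Line (Option α) ι, ∃ a, l a ∉ A} with hS
  have hS0 : δ0 ∈ S := fun ι hι => hcon ι hι
  have hSb : ∀ δ ∈ S, δ ≤ 1 := by
    intro δ hδ
    obtain ⟨A, hA, -⟩ := hδ Unit inferInstance
    exact hA.trans (av_le fun _ => ind_le_one _)
  have hbdd : BddAbove S := ⟨1, hSb⟩
  set δ := sSup S with hδdef
  have hδpos : 0 < δ := hδ0.trans_le (le_csSup hbdd hS0)
  have hδ1 : δ ≤ 1 := csSup_le ⟨_, hS0⟩ hSb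
  have hup : ∀ η > 0, ∃ (ι : Type) (_ : Finite ι), ∀ A : Set (ι → Option α),
      (∀ l : Line (Option α) ι, ∃ a, l a ∉ A) → av (fun x => ind (x ∈ A)) ≤ δ + η := by
    intro η hη
    by_contra hc
    push Not at hc
    have : δ + η ∈ S := by
      intro ι hι
      obtain ⟨A, hA, hA'⟩ := hc ι hι
      exact ⟨A, hA'.le, hA⟩
    linarith [le_csSup hbdd this]
  have hdown : ∀ η > 0, ∀ (ι : Type) (_ : Finite ι), ∃ A : Set (ι → Option α),
      δ - η ≤ av (fun x => ind (x ∈ A)) ∧ ∀ l : Line (Option α) ι, ∃ a, l a ∉ A := by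
    intro η hη ι hι
    obtain ⟨δ', hδ', hlt⟩ := exists_lt_of_lt_csSup (⟨_, hS0⟩ : S.Nonempty)
      (show δ - η < sSup S by linarith)
    obtain ⟨A, hA, hA'⟩ := hδ' ι hι
    exact ⟨A, by linarith, hA'⟩
  obtain ⟨κ, hκ, Hκ⟩ := h (δ / 4) (by positivity)
  have hNpos : (1 : ℝ) ≤ Nat.card (κ → Option α) := by exact_mod_cast Nat.card_pos
  set θ : ℝ := (δ / 4) / Nat.card (κ → Option α) with hθ
  have hθ0 : 0 < θ := by positivity
  have hθ1 : θ ≤ 1 := by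
    rw [hθ, div_le_one (by linarith)]; linarith
  set η : ℝ := δ * θ / 8 with hη
  have hη0 : 0 < η := by positivity
  have hη1 : η ≤ δ / 8 := by rw [hη]; nlinarith
  obtain ⟨τ, hτ, Hτ⟩ := hup η hη0
  cases nonempty_fintype α
  obtain ⟨m, hm, Hm⟩ := insens_cover_inter hM (Finset.univ.toList) τ η hη0
  obtain ⟨ι1, hι1, -, HQ⟩ := avoid_dichotomy (α := α) m κ Unit
  obtain ⟨ι, hι, HU⟩ := uniform_fibres' (Option α) ι1 η (δ - η) hη0
  obtain ⟨A, hAd, hAfree⟩ := hdown η hη0 ι hι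
  obtain ⟨Z, hZ, hZn, V, hV⟩ := HU A hAd
  rcases HQ (fun _ => {x | (∃ i, x i = none) ∧
    θ ≤ av (fun z => ind (∀ a, V z (fill a x) ∈ A))}) with ⟨-, U, hU⟩ | ⟨W, hW⟩
  · -- all points of `U` are good
    have hz : ∀ z, av (fun u => ind (V z (U u) ∈ A)) - (δ + η) +
        (δ + η) * av (fun u => ind (∀ a, V z (fill a (U u)) ∈ A)) ≤ η := by
      intro z
      have hD : ∀ a : α, Insens a {u | U u ∈ {x | V z (fill a x) ∈ A}} := by
        intro a
        refine Insens.comp (fun x y hxy hx => ?_) U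
        have : fill a x = fill a y := by
          funext i; simp only [fill, hxy i]
        change V z (fill a y) ∈ A
        rw [← this]; exact hx
      have key := (Hm (fun a => {u | U u ∈ {x | V z (fill a x) ∈ A}}) hD
        (fun u => ind (V z (U u) ∈ A) - (δ + η)) (fun u => by
          linarith [ind_le_one (V z (U u) ∈ A)]) (fun W => by
          rw [av_sub, av_const]
          have := Hτ {y | V z (U (W y)) ∈ A} (fun l => by
            obtain ⟨a, ha⟩ := hAfree (lineComp (V z) (lineComp U (lineComp W l)))
            refine ⟨a, ?_⟩
            rw [lineComp_apply, lineComp_apply, lineComp_apply] at ha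
            exact ha)
          have h2 : av (fun x => ind (x ∈ {y | V z (U (W y)) ∈ A})) =
            av (fun x => ind (V z (U (W x)) ∈ A)) := rfl
          linarith)).2
      have e1 : av (fun u => (ind (V z (U u) ∈ A) - (δ + η)) +
          (δ + η) * ind (∀ a, V z (fill a (U u)) ∈ A)) ≤ η := by
        refine le_trans (av_mono fun u => ?_) key
        have e2 : ind (∀ a ∈ Finset.univ.toList, u ∈ {u | U u ∈ {x | V z (fill a x) ∈ A}}) =
            ind (∀ a, V z (fill a (U u)) ∈ A) := by
          simp
        rw [e2]
        by_cases hc : ∀ a, V z (fill a (U u)) ∈ A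
        · have : V z (U u) ∉ A := by
            intro hin
            obtain ⟨b, hb⟩ := hAfree (lineComp (V z) (optLine (U u) (hU u).1))
            rw [lineComp_apply] at hb
            cases b with
            | none => rw [optLine_none] at hb; exact hb hin
            | some a => rw [optLine_some] at hb; exact hb (hc a)
          rw [ind_true hc, ind_false this]
          linarith
        · rw [ind_false hc]
          linarith
      rw [av_add, av_sub, av_const, av_mul_left] at e1
      exact e1
    have h1 : av (fun z => av (fun u => ind (V z (U u) ∈ A)) - (δ + η) +
        (δ + η) * av (fun u => ind (∀ a, V z (fill a (U u)) ∈ A))) ≤ η := av_le hz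
    rw [av_add, av_sub, av_const, av_mul_left, av_comm, av_comm (fun z u => ind (∀ a, _))] at h1
    have h2 : δ - η - η ≤ av (fun u => av (fun z => ind (V z (U u) ∈ A))) :=
      le_av fun u => hV (U u)
    have h3 : θ ≤ av (fun u => av (fun z => ind (∀ a, V z (fill a (U u)) ∈ A))) :=
      le_av fun u => (hU u).2
    have h4 : (δ + η) * θ ≤
      (δ + η) * av (fun u => av (fun z => ind (∀ a, V z (fill a (U u)) ∈ A))) := by gcongr
    have h5 : 0 < η * θ := by positivity
    have h6 : 0 < δ * θ := by positivity
    nlinarith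
  · have h1 : δ / 2 ≤ av (fun y : κ → α => av (fun z => ind (V z (fun i => some (W y i)) ∈ A))) :=
      le_av fun y => by linarith [hV (fun i => some (W y i))]
    rw [av_comm] at h1
    have h2 := markov_half (fun z => av_le fun y => ind_le_one _) h1 (by positivity)
    have h3 : δ / 4 ≤ av (fun z => ind (∃ v : κ → Option α, (∃ e, v e = none) ∧
        ∀ a, V z (fill a (subLift W v)) ∈ A)) := by
      refine le_trans (le_trans (by linarith) h2) (av_mono fun z => ind_mono fun hz => ?_)
      obtain ⟨l, hl⟩ := Hκ {y | V z (fun i => some (W y i)) ∈ A} (by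
        refine le_trans (by linarith) hz)
      refine ⟨l.idxFun, l.proper, fun a => ?_⟩
      have : fill a (subLift W l.idxFun) = fun i => some (W (l a) i) := by
        funext i
        simp only [fill, subLift_getD]
        rfl
      rw [this]
      exact hl a
    obtain ⟨v, hv⟩ := exists_of_av_exists h3
    by_cases hn : ∃ e, v e = none
    · refine hW () v hn ⟨?_, ?_⟩
      · obtain ⟨e, he⟩ := hn
        obtain ⟨i, hi⟩ := (subLift W).proper e
        exact ⟨i, by rw [Subspace.apply_inr hi, he]⟩
      · exact hv.trans (av_mono fun z => ind_mono fun hz => hz.2)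
    · have : av (fun z => ind ((∃ e, v e = none) ∧
        ∀ a, V z (fill a (subLift W v)) ∈ A)) ≤ 0 := av_le fun z => by
          rw [ind_false fun hh => hn hh.1]
      linarith

end DHJStep

theorem dhj_unit : DHJ Unit := by
  intro δ hδ
  refine ⟨Unit, inferInstance, fun A hA => ?_⟩
  obtain ⟨x, hx⟩ := exists_of_av_ind_pos (lt_of_lt_of_le hδ hA)
  refine ⟨⟨fun _ => none, ⟨(), rfl⟩⟩, fun a => ?_⟩
  convert hx

theorem dhj_exists (k : ℕ) : ∃ (α : Type) (_ : Finite α) (_ : Nonempty α),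
    Nat.card α = k + 1 ∧ DHJ α := by
  induction k with
  | zero => exact ⟨Unit, inferInstance, inferInstance, by simp, dhj_unit⟩
  | succ k ih =>
    obtain ⟨α, hα, hα', hc, h⟩ := ih
    exact ⟨Option α, inferInstance, inferInstance, by rw [Finite.card_option, hc], dhj_step h⟩

/-! ### Supersaturated Szemeredi theorem -/

open Combinatorics

lemma av_ind_eq {X : Type*} [Fintype X] (p : X → Prop) [DecidablePred p] :
    av (fun x => ind (p x)) = ((Finset.univ.filter p).card : ℝ) / Fintype.card X := by
  rw [av_eq]
  congr 1
  rw [Finset.card_filter]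
  push_cast
  refine Finset.sum_congr rfl fun x _ => ?_
  by_cases h : p x <;> simp [ind, h]

open Classical in
theorem szemeredi_supersat (k : ℕ) (hk : 1 ≤ k) (β : ℝ) (hβ : 0 < β) (hβ1 : β ≤ 1) :
    ∃ c : ℝ, 0 < c ∧ ∃ n₁ : ℕ, ∀ n : ℕ, n₁ ≤ n → ∀ X : Finset ℕ, X ⊆ Finset.Icc 1 n →
      β * n ≤ X.card → c * (n : ℝ) ^ 2 ≤
        (((Finset.Icc 1 n ×ˢ Finset.Icc 1 n).filter
          (fun q : ℕ × ℕ => ∀ i < k, q.1 + i * q.2 ∈ X)).card : ℝ) := by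
  obtain ⟨α, hα, hα', hcard, hD⟩ := dhj_exists (k - 1)
  rw [Nat.sub_add_cancel hk] at hcard
  cases nonempty_fintype α
  rw [Nat.card_eq_fintype_card] at hcard
  set e : α ≃ Fin k := Fintype.equivFinOfCardEq hcard with he
  obtain ⟨ι, hι, HD⟩ := hD (β / 4) (by positivity)
  cases nonempty_fintype ι
  set φ : (ι → α) → ℕ := fun x => ∑ i, (e (x i) : ℕ) with hφ
  set L : ℕ := k * Fintype.card ι + 1 with hL
  have hL1 : (1 : ℝ) ≤ L := by rw [hL]; push_cast; nlinarith [Nat.cast_nonneg (α := ℝ) k, Nat.cast_nonneg (α := ℝ) (Fintype.card ι)]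
  have hφL : ∀ x, φ x ≤ L := by
    intro x
    have : φ x ≤ ∑ i : ι, k := Finset.sum_le_sum fun i _ => (e (x i)).2.le
    rw [Finset.sum_const, Finset.card_univ, smul_eq_mul] at this
    rw [hL]
    nlinarith
  have hN1 : (1 : ℝ) ≤ Nat.card (ι → Option α) := by exact_mod_cast Nat.card_pos
  set N : ℝ := (Nat.card (ι → Option α) : ℝ) with hN
  refine ⟨β / 4 / N * (β / (4 * L)), by positivity, ⌈4 * L / β⌉₊, fun n hn X hX hXc => ?_⟩
  have hn' : 4 * L / β ≤ n := (Nat.le_ceil _).trans (by exact_mod_cast hn)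
  rw [div_le_iff₀ hβ] at hn'
  have hnpos : (0 : ℝ) < n := by
    by_contra hc
    nlinarith
  have hn0 : 0 < n := by exact_mod_cast hnpos
  set D : ℕ := ⌊β * n / (2 * L)⌋₊ with hDd
  have hDle : (D : ℝ) * L ≤ β * n / 2 := by
    have : (D : ℝ) ≤ β * n / (2 * L) := Nat.floor_le (by positivity)
    rw [le_div_iff₀ (by positivity)] at this
    linarith
  have hbig : 2 ≤ β * n / (2 * L) := by
    rw [le_div_iff₀ (by positivity)]; linarith
  have hDge : β * n / (4 * L) ≤ D := by
    have h1 : β * n / (2 * L) < D + 1 := Nat.lt_floor_add_one _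
    have h2 : β * n / (2 * L) = 2 * (β * n / (4 * L)) := by field_simp; norm_num
    linarith
  have hD1 : 1 ≤ D := Nat.le_floor (by push_cast; linarith)
  have : NeZero D := ⟨by omega⟩
  have : NeZero n := ⟨by omega⟩
  -- averaging
  have hav : ∀ x : ι → α, β / 2 ≤ av (fun p : Fin n × Fin D =>
      ind ((p.1 + 1 : ℕ) + (p.2 + 1) * φ x ∈ X)) := by
    intro x
    rw [av_prod, av_comm (fun (a : Fin n) (d : Fin D) => ind ((a + 1 : ℕ) + (d + 1) * φ x ∈ X))]
    refine le_av fun d => ?_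
    rw [av_ind_eq, Fintype.card_fin, le_div_iff₀ hnpos]
    have h1 : X.card ≤ (Finset.univ.filter (fun a : Fin n =>
        (a + 1 : ℕ) + (d + 1) * φ x ∈ X)).card + (d + 1) * φ x := by
      set s := (d + 1 : ℕ) * φ x with hs
      have hsub : X ⊆ ((Finset.univ.filter (fun a : Fin n => (a + 1 : ℕ) + s ∈ X)).image
          (fun a : Fin n => (a + 1 : ℕ) + s)) ∪ Finset.Icc 1 s := by
        intro y hy
        have hy' := Finset.mem_Icc.1 (hX hy)
        rw [Finset.mem_union]
        by_cases hys : y ≤ s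
        · right; rw [Finset.mem_Icc]; exact ⟨hy'.1, hys⟩
        · left
          rw [Finset.mem_image]
          refine ⟨⟨y - s - 1, by omega⟩, ?_, ?_⟩
          · rw [Finset.mem_filter]
            refine ⟨Finset.mem_univ _, ?_⟩
            have : y - s - 1 + 1 + s = y := by omega
            simpa only [this] using hy
          · simp only; omega
      refine (Finset.card_le_card hsub).trans ((Finset.card_union_le _ _).trans ?_)
      gcongr
      · exact Finset.card_image_le
      · simp
    have h2 : ((d : ℕ) + 1) * φ x ≤ D * L := Nat.mul_le_mul d.2 (hφL x)
    have h3 : (X.card : ℝ) ≤ (Finset.univ.filter (fun a : Fin n =>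
        (a + 1 : ℕ) + (d + 1) * φ x ∈ X)).card + (D : ℝ) * L := by exact_mod_cast h1.trans (by omega)
    linarith
  have h1 : β / 2 ≤ av (fun x : ι → α => av (fun p : Fin n × Fin D =>
      ind ((p.1 + 1 : ℕ) + (p.2 + 1) * φ x ∈ X))) := le_av hav
  rw [av_comm] at h1
  have h2 := markov_half (fun z => av_le fun y => ind_le_one _) h1 (by positivity)
  have h3 : β / 4 ≤ av (fun p : Fin n × Fin D => ind (∃ v : ι → Option α, (∃ i, v i = none) ∧
        ∀ a, (p.1 + 1 : ℕ) + (p.2 + 1) * φ (fun i => (v i).getD a) ∈ X)) := by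
    refine le_trans (le_trans (by linarith) h2) (av_mono fun p => ind_mono fun hz => ?_)
    obtain ⟨l, hl⟩ := HD {x | (p.1 + 1 : ℕ) + (p.2 + 1) * φ x ∈ X} (by
        refine le_trans (by linarith) hz)
    exact ⟨l.idxFun, l.proper, fun a => hl a⟩
  obtain ⟨v, hv⟩ := exists_of_av_exists h3
  have hvn : ∃ i, v i = none := by
    by_contra hn
    have : av (fun p : Fin n × Fin D => ind ((∃ i, v i = none) ∧
        ∀ a, (p.1 + 1 : ℕ) + (p.2 + 1) * φ (fun i => (v i).getD a) ∈ X)) ≤ 0 := av_le fun z => by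
          rw [ind_false fun hh => hn hh.1]
    have : 0 < β / 4 / N := by positivity
    linarith
  rw [av_ind_eq, le_div_iff₀ (by rw [Fintype.card_prod, Fintype.card_fin, Fintype.card_fin]; positivity)] at hv
  rw [Fintype.card_prod, Fintype.card_fin, Fintype.card_fin] at hv
  set w := (Finset.univ.filter (fun i => v i = none)).card with hw
  have hw1 : 1 ≤ w := by
    obtain ⟨i, hi⟩ := hvn
    exact Finset.card_pos.2 ⟨i, by simp [hi]⟩
  have hwι : w ≤ L := by
    have : w ≤ Fintype.card ι := Finset.card_le_univ _
    rw [hL]; nlinarith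
  set c0 : ℕ := ∑ i, (v i).elim 0 (fun a => (e a : ℕ)) with hc0
  have hφv : ∀ a, φ (fun i => (v i).getD a) = c0 + e a * w := by
    intro a
    have : (e a : ℕ) * w = ∑ i, if v i = none then (e a : ℕ) else 0 := by
      rw [Finset.sum_ite, Finset.sum_const, Finset.sum_const_zero, hw, smul_eq_mul, mul_comm, add_zero]
    rw [this, hc0, ← Finset.sum_add_distrib]
    refine Finset.sum_congr rfl fun i _ => ?_
    cases hvi : v i <;> simp [hvi]
  have hcard2 : (Finset.univ.filter (fun p : Fin n × Fin D => (∃ i, v i = none) ∧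
        ∀ a, (p.1 + 1 : ℕ) + (p.2 + 1) * φ (fun i => (v i).getD a) ∈ X)).card ≤
      ((Finset.Icc 1 n ×ˢ Finset.Icc 1 n).filter
          (fun q : ℕ × ℕ => ∀ i < k, q.1 + i * q.2 ∈ X)).card := by
    refine Finset.card_le_card_of_injOn
      (fun p => ((p.1 + 1 : ℕ) + (p.2 + 1) * c0, (p.2 + 1) * w)) ?_ ?_
    · intro p hp
      rw [Finset.mem_coe, Finset.mem_filter] at hp
      have hmem : ∀ i < k, ((p.1 + 1 : ℕ) + (p.2 + 1) * c0) + i * ((p.2 + 1) * w) ∈ X := by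
        intro i hi
        have := hp.2.2 (e.symm ⟨i, hi⟩)
        rw [hφv, Equiv.apply_symm_apply] at this
        convert this using 1
        simp only
        ring
      rw [Finset.mem_coe, Finset.mem_filter, Finset.mem_product]
      refine ⟨⟨?_, ?_⟩, hmem⟩
      · have := hX (hmem 0 (by omega))
        simpa using this
      · rw [Finset.mem_Icc]
        refine ⟨Nat.mul_pos (Nat.succ_pos _) hw1, ?_⟩
        have a1 : ((p.2 : ℕ) + 1) * w ≤ D * L := Nat.mul_le_mul p.2.2 hwι
        have a2 : ((D * L : ℕ) : ℝ) ≤ n := by push_cast; nlinarith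
        exact a1.trans (by exact_mod_cast a2)
    · intro p _ q _ hpq
      simp only [Prod.mk.injEq] at hpq
      obtain ⟨q1, q2⟩ := hpq
      have q3 : (p.2 : ℕ) + 1 = q.2 + 1 := Nat.eq_of_mul_eq_mul_right hw1 q2
      rw [q3] at q1
      ext
      · omega
      · omega
  have hcard3 : ((Finset.univ.filter (fun p : Fin n × Fin D => (∃ i, v i = none) ∧
        ∀ a, (p.1 + 1 : ℕ) + (p.2 + 1) * φ (fun i => (v i).getD a) ∈ X)).card : ℝ) ≤
      ((Finset.Icc 1 n ×ˢ Finset.Icc 1 n).filter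
          (fun q : ℕ × ℕ => ∀ i < k, q.1 + i * q.2 ∈ X)).card := by exact_mod_cast hcard2
  refine le_trans (le_trans ?_ hv) hcard3
  push_cast
  calc β / 4 / N * (β / (4 * L)) * (n : ℝ) ^ 2 = β / 4 / N * (n * (β * n / (4 * L))) := by ring
    _ ≤ β / 4 / N * (n * D) := by gcongr

/-! ### Hypergraph containers -/

section containers

/-- Every member of `F` is covered by a container determined by a small fingerprint. -/
def Cov (K : Finset ℕ) (F : Set (Finset ℕ)) (s M : ℝ) : Prop :=
  ∃ f : Finset ℕ → Finset ℕ, (∀ S, ((f S).card : ℝ) ≤ M) ∧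
    ∀ I ∈ F, ∃ S, K ⊆ S ∧ S ⊆ I ∧ (S.card : ℝ) ≤ s ∧ I ⊆ f S

lemma cov_branch {K : Finset ℕ} {F : Set (Finset ℕ)} {s M : ℝ} (v : ℕ)
    (h1 : Cov (insert v K) {I | I ∈ F ∧ v ∈ I} s M) (h2 : Cov K {I | I ∈ F ∧ v ∉ I} s M) :
    Cov K F s M := by
  obtain ⟨f, hf, hf'⟩ := h1
  obtain ⟨g, hg, hg'⟩ := h2
  refine ⟨fun S => if v ∈ S then f S else g S, fun S => ?_, fun I hI => ?_⟩
  · dsimp only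
    split_ifs
    · exact hf S
    · exact hg S
  · by_cases hv : v ∈ I
    · obtain ⟨S, a, b, c, d⟩ := hf' I ⟨hI, hv⟩
      have hvS : v ∈ S := a (Finset.mem_insert_self _ _)
      exact ⟨S, (Finset.subset_insert _ _).trans a, b, c, by simpa [hvS] using d⟩
    · obtain ⟨S, a, b, c, d⟩ := hg' I ⟨hI, hv⟩
      have hvS : v ∉ S := fun h => hv (b h)
      exact ⟨S, a, b, c, by simpa [hvS] using d⟩

/-- Weighted degree. -/
def dg (V : Finset ℕ) (w : Finset ℕ → ℝ) (T : Finset ℕ) : ℝ :=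
  ∑ E ∈ V.powerset.filter (fun E => T ⊆ E), w E

lemma dg_empty (V : Finset ℕ) (w : Finset ℕ → ℝ) : dg V w ∅ = ∑ E ∈ V.powerset, w E := by
  simp [dg]

lemma dg_nonneg {V : Finset ℕ} {w : Finset ℕ → ℝ} (h : ∀ E, 0 ≤ w E) (T : Finset ℕ) :
    0 ≤ dg V w T := Finset.sum_nonneg fun E _ => h E

lemma dg_mono {V : Finset ℕ} {w w' : Finset ℕ → ℝ} (h : ∀ E, w E ≤ w' E) (T : Finset ℕ) :
    dg V w T ≤ dg V w' T := Finset.sum_le_sum fun E _ => h E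

lemma dg_add (V : Finset ℕ) (w w' : Finset ℕ → ℝ) (T : Finset ℕ) :
    dg V (fun E => w E + w' E) T = dg V w T + dg V w' T := Finset.sum_add_distrib

lemma dg_sum (V : Finset ℕ) (w : Finset ℕ → ℝ) (A : Finset (Finset ℕ)) :
    ∑ T ∈ A, dg V w T = ∑ E ∈ V.powerset, w E * ((A.filter (fun T => T ⊆ E)).card : ℝ) := by
  simp only [dg, Finset.sum_filter]
  rw [Finset.sum_comm]
  refine Finset.sum_congr rfl fun E _ => ?_
  rw [← Finset.sum_filter, Finset.sum_const, nsmul_eq_mul, mul_comm]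

/-- Link weight. -/
def lk (v : ℕ) (w : Finset ℕ → ℝ) (F : Finset ℕ) : ℝ := if v ∈ F then 0 else w (insert v F)

lemma dg_lk_of_mem {V : Finset ℕ} {w : Finset ℕ → ℝ} {v : ℕ} {T : Finset ℕ} (h : v ∈ T) :
    dg V (lk v w) T = 0 := by
  refine Finset.sum_eq_zero fun F hF => ?_
  rw [Finset.mem_filter] at hF
  rw [lk, if_pos (hF.2 h)]

lemma dg_lk_of_notMem {V : Finset ℕ} {w : Finset ℕ → ℝ} {v : ℕ} (hv : v ∈ V) {T : Finset ℕ}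
    (h : v ∉ T) : dg V (lk v w) T = dg V w (insert v T) := by
  have h1 : dg V (lk v w) T =
      ∑ F ∈ V.powerset.filter (fun F => T ⊆ F ∧ v ∉ F), w (insert v F) := by
    rw [dg, Finset.sum_filter, Finset.sum_filter]
    simp only [lk]
    refine Finset.sum_congr rfl fun F _ => ?_
    by_cases a : T ⊆ F <;> by_cases b : v ∈ F <;> simp [a, b]
  rw [h1, dg]
  refine Finset.sum_nbij' (fun F => insert v F) (fun E => E.erase v) ?_ ?_ ?_ ?_ ?_
  · intro F hF
    simp only [Finset.mem_filter, Finset.mem_powerset] at hF ⊢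
    exact ⟨Finset.insert_subset hv hF.1, Finset.insert_subset_insert v hF.2.1⟩
  · intro E hE
    simp only [Finset.mem_filter, Finset.mem_powerset] at hE ⊢
    refine ⟨(Finset.erase_subset _ _).trans hE.1, ?_, Finset.notMem_erase _ _⟩
    intro x hx
    rw [Finset.mem_erase]
    exact ⟨fun hxv => h (hxv ▸ hx), hE.2 (Finset.mem_insert_of_mem hx)⟩
  · intro F hF
    simp only [Finset.mem_filter] at hF
    exact Finset.erase_insert hF.2.2
  · intro E hE
    simp only [Finset.mem_filter] at hE
    exact Finset.insert_erase (hE.2 (Finset.mem_insert_self _ _))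
  · intro F hF
    rfl

/-- The container step for `r`-uniform weights. -/
def CL (r : ℕ) : Prop :=
  ∀ c C : ℝ, 0 < c → 0 < C → ∃ ε B : ℝ, 0 < ε ∧ ε ≤ 1 ∧ 0 < B ∧
    ∀ (V : Finset ℕ) (p q : ℝ), 0 < p → p ≤ 1 → 0 < q → ∀ w : Finset ℕ → ℝ, (∀ E, 0 ≤ w E) →
      (∀ E, w E ≠ 0 → E.card = r) → c * q * V.card ≤ dg V w ∅ →
      (∀ T : Finset ℕ, T.Nonempty → dg V w T ≤ C * p ^ (T.card - 1) * q) →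
      ∀ (F : Set (Finset ℕ)) (K : Finset ℕ) (s M : ℝ),
        (∀ I ∈ F, K ⊆ I ∧ I ⊆ V ∧ ∀ E, E ⊆ I → w E = 0) →
        (∀ (F' : Set (Finset ℕ)) (K' : Finset ℕ), F' ⊆ F →
          (K'.card : ℝ) ≤ K.card + B * (p * V.card + 1) → (∀ I ∈ F', K' ⊆ I) →
          (∃ X' : Finset ℕ, X' ⊆ V ∧ (X'.card : ℝ) ≤ (1 - ε) * V.card ∧ ∀ I ∈ F', I ⊆ X') →
            Cov K' F' s M) →
        Cov K F s M

lemma cl_one : CL 1 := by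
  classical
  intro c C hc hC
  refine ⟨min (c / C) 1, 1, lt_min (by positivity) one_pos, min_le_right _ _, one_pos, ?_⟩
  intro V p q hp hp1 hq w hw0 hwc hsum hdeg F K s M hF hcont
  refine hcont F K subset_rfl ?_ (fun I hI => (hF I hI).1)
    ⟨V.filter (fun v => w {v} = 0), Finset.filter_subset _ _, ?_, ?_⟩
  · have : 0 ≤ p * V.card := by positivity
    linarith
  · have h1 : dg V w ∅ ≤ ∑ v ∈ V, w {v} := by
      rw [dg_empty]
      have : ∑ v ∈ V, w {v} = ∑ E ∈ V.image (fun v => ({v} : Finset ℕ)), w E := by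
        rw [Finset.sum_image]
        intro a _ b _ hab
        simpa using hab
      rw [this]
      have hsub : V.image (fun v => ({v} : Finset ℕ)) ⊆ V.powerset := by
        intro E hE
        obtain ⟨v, hv, rfl⟩ := Finset.mem_image.1 hE
        simpa using hv
      refine le_of_eq (Finset.sum_subset hsub ?_).symm
      intro E hE hE'
      by_contra hne
      obtain ⟨v, rfl⟩ := Finset.card_eq_one.1 (hwc E hne)
      apply hE'
      rw [Finset.mem_image]
      exact ⟨v, by simpa using hE, rfl⟩
    have h2 : ∑ v ∈ V, w {v} ≤ (V.filter (fun v => ¬ w {v} = 0)).card * (C * q) := by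
      rw [← Finset.sum_filter_add_sum_filter_not V (fun v => w {v} = 0)]
      rw [Finset.sum_eq_zero (s := V.filter (fun v => w {v} = 0)) (fun v hv => (Finset.mem_filter.1 hv).2),
        zero_add, ← nsmul_eq_mul]
      refine Finset.sum_le_card_nsmul _ _ _ fun v hv => ?_
      have h3 := hdeg {v} (by simp)
      have h4 : w {v} ≤ dg V w {v} := by
        refine Finset.single_le_sum (f := w) (fun E _ => hw0 E) ?_
        simpa using (Finset.mem_filter.1 hv).1
      simpa using h4.trans h3
    have h3 := Finset.card_filter_add_card_filter_not (s := V) (fun v => w {v} = 0)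
    have h4 : ((V.filter (fun v => w {v} = 0)).card : ℝ) +
      (V.filter (fun v => ¬ w {v} = 0)).card = V.card := by exact_mod_cast h3
    have h5 : c * q * V.card ≤ (V.filter (fun v => ¬ w {v} = 0)).card * (C * q) := by linarith
    have h6 : c / C * V.card ≤ (V.filter (fun v => ¬ w {v} = 0)).card := by
      rw [div_mul_eq_mul_div, div_le_iff₀ hC]
      nlinarith
    have h7 : min (c / C) 1 * V.card ≤ c / C * V.card := by
      gcongr
      exact min_le_left _ _
    linarith
  · intro I hI v hv
    rw [Finset.mem_filter]
    exact ⟨(hF I hI).2.1 hv, (hF I hI).2.2 _ (by simpa using hv)⟩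

end containers

section containerstep

/-- Pruning: a vertex of large degree avoiding the removed set and the saturated sets. -/
lemma cl_pick {r : ℕ} {c C c' ε : ℝ} (hc : 0 < c) (hC : 0 < C) (hc' : c' * 2 ^ r = c / 4)
    (hε : ε * C ≤ c / 4) {V : Finset ℕ} {p q : ℝ} (hp : 0 < p) (hq : 0 < q)
    {w : Finset ℕ → ℝ} (hw0 : ∀ E, 0 ≤ w E) (hwc : ∀ E, w E ≠ 0 → E.card = r + 1)
    (hsum : c * q * V.card ≤ dg V w ∅)
    (hdeg : ∀ T : Finset ℕ, T.Nonempty → dg V w T ≤ C * p ^ (T.card - 1) * q)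
    {X : Finset ℕ} (hX : (X.card : ℝ) < ε * V.card)
    {g : Finset ℕ → ℝ} (hg0 : ∀ E, 0 ≤ g E) (hgc : ∀ E, g E ≠ 0 → E.card = r)
    (hg : dg V g ∅ < c' * (p * q) * V.card) :
    ∃ w' : Finset ℕ → ℝ, (∀ E, 0 ≤ w' E) ∧ (∀ E, w' E ≤ w E) ∧
      (∀ T : Finset ℕ, T.Nonempty → C * p ^ T.card * q ≤ dg V g T → ∀ E, T ⊆ E → E ⊆ V →
        w' E = 0) ∧
      ∃ v ∈ V, v ∉ X ∧ c / 2 * q ≤ dg V w' {v} := by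
  classical
  set Sat := V.powerset.filter (fun T => T.Nonempty ∧ C * p ^ T.card * q ≤ dg V g T) with hSat
  set w' : Finset ℕ → ℝ := fun E => if (Disjoint E X ∧ ∀ T ∈ Sat, ¬ T ⊆ E) then w E else 0 with hw'
  have hw'0 : ∀ E, 0 ≤ w' E := by
    intro E; simp only [hw']; split_ifs
    · exact hw0 E
    · exact le_rfl
  have hw'w : ∀ E, w' E ≤ w E := by
    intro E; simp only [hw']; split_ifs
    · exact le_rfl
    · exact hw0 E
  refine ⟨w', hw'0, hw'w, ?_, ?_⟩
  · intro T hT hTs E hTE hEV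
    simp only [hw']
    rw [if_neg]
    rintro ⟨-, h⟩
    refine h T ?_ hTE
    rw [hSat, Finset.mem_filter, Finset.mem_powerset]
    exact ⟨hTE.trans hEV, hT, hTs⟩
  have l1 : dg V w ∅ ≤ dg V w' ∅ + ∑ T ∈ X.image (fun v => ({v} : Finset ℕ)), dg V w T +
      ∑ T ∈ Sat, dg V w T := by
    rw [dg_sum, dg_sum, dg_empty, dg_empty, ← Finset.sum_add_distrib, ← Finset.sum_add_distrib]
    refine Finset.sum_le_sum fun E _ => ?_
    have n1 : 0 ≤ w E * (((X.image (fun v => ({v} : Finset ℕ))).filter (fun T => T ⊆ E)).card : ℝ) :=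
      mul_nonneg (hw0 E) (Nat.cast_nonneg _)
    have n2 : 0 ≤ w E * ((Sat.filter (fun T => T ⊆ E)).card : ℝ) :=
      mul_nonneg (hw0 E) (Nat.cast_nonneg _)
    by_cases h1 : Disjoint E X
    · by_cases h2 : ∀ T ∈ Sat, ¬ T ⊆ E
      · have : w' E = w E := by simp only [hw']; rw [if_pos ⟨h1, h2⟩]
        linarith
      · push Not at h2
        obtain ⟨T, hT, hTE⟩ := h2
        have : (1 : ℝ) ≤ ((Sat.filter (fun T => T ⊆ E)).card : ℝ) := by
          exact_mod_cast Finset.card_pos.2 ⟨T, Finset.mem_filter.2 ⟨hT, hTE⟩⟩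
        have := mul_le_mul_of_nonneg_left this (hw0 E)
        linarith [hw'0 E]
    · rw [Finset.not_disjoint_iff] at h1
      obtain ⟨v, hvE, hvX⟩ := h1
      have : (1 : ℝ) ≤ (((X.image (fun v => ({v} : Finset ℕ))).filter (fun T => T ⊆ E)).card : ℝ) := by
        exact_mod_cast Finset.card_pos.2 ⟨{v}, Finset.mem_filter.2
          ⟨Finset.mem_image.2 ⟨v, hvX, rfl⟩, by simpa using hvE⟩⟩
      have := mul_le_mul_of_nonneg_left this (hw0 E)
      linarith [hw'0 E]
  have l2 : ∑ T ∈ X.image (fun v => ({v} : Finset ℕ)), dg V w T ≤ c / 4 * q * V.card := by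
    have a1 : ∑ T ∈ X.image (fun v => ({v} : Finset ℕ)), dg V w T ≤
        (X.image (fun v => ({v} : Finset ℕ))).card • (C * q) := by
      refine Finset.sum_le_card_nsmul _ _ _ fun T hT => ?_
      obtain ⟨v, -, rfl⟩ := Finset.mem_image.1 hT
      simpa using hdeg {v} (by simp)
    have a2 : ((X.image (fun v => ({v} : Finset ℕ))).card : ℝ) ≤ X.card := by
      exact_mod_cast Finset.card_image_le
    rw [nsmul_eq_mul] at a1
    calc _ ≤ _ := a1
      _ ≤ (ε * V.card) * (C * q) := by gcongr; linarith
      _ = (ε * C) * (q * V.card) := by ring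
      _ ≤ c / 4 * (q * V.card) := by gcongr
      _ = _ := by ring
  have l3 : ∑ T ∈ Sat, dg V w T ≤ c / 4 * q * V.card := by
    have a1 : ∑ T ∈ Sat, dg V w T ≤ ∑ T ∈ Sat, (1 / p) * dg V g T := by
      refine Finset.sum_le_sum fun T hT => ?_
      rw [hSat, Finset.mem_filter] at hT
      refine (hdeg T hT.2.1).trans ?_
      rw [one_div, ← div_eq_inv_mul, le_div_iff₀ hp]
      refine le_trans (le_of_eq ?_) hT.2.2
      have : p ^ T.card = p ^ (T.card - 1) * p := by
        rw [← pow_succ, Nat.sub_add_cancel (Finset.card_pos.2 hT.2.1)]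
      rw [this]; ring
    have a2 : ∑ T ∈ Sat, dg V g T ≤ 2 ^ r * dg V g ∅ := by
      rw [dg_sum, dg_empty, Finset.mul_sum]
      refine Finset.sum_le_sum fun E _ => ?_
      by_cases hE : g E = 0
      · simp [hE]
      · have b1 : (Sat.filter (fun T => T ⊆ E)).card ≤ 2 ^ r := by
          rw [← hgc E hE, ← Finset.card_powerset]
          refine Finset.card_le_card fun T hT => ?_
          rw [Finset.mem_filter] at hT
          exact Finset.mem_powerset.2 hT.2
        have b2 : ((Sat.filter (fun T => T ⊆ E)).card : ℝ) ≤ 2 ^ r := by exact_mod_cast b1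
        rw [mul_comm]
        exact mul_le_mul_of_nonneg_right b2 (hg0 E)
    rw [← Finset.mul_sum] at a1
    calc _ ≤ _ := a1
      _ ≤ (1 / p) * (2 ^ r * (c' * (p * q) * V.card)) := by
        gcongr
        exact a2.trans (by gcongr)
      _ = (c' * 2 ^ r) * q * V.card := by field_simp
      _ = _ := by rw [hc']
  have l4 : c / 2 * q * V.card ≤ dg V w' ∅ := by linarith
  have hVne : V.Nonempty := by
    by_contra hV
    rw [Finset.not_nonempty_iff_eq_empty] at hV
    rw [hV] at hX
    simp at hX
    have : (0 : ℝ) ≤ X.card := Nat.cast_nonneg _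
    linarith
  have l5 : dg V w' ∅ ≤ ∑ v ∈ V, dg V w' {v} := by
    have : ∑ v ∈ V, dg V w' {v} = ∑ T ∈ V.image (fun v => ({v} : Finset ℕ)), dg V w' T := by
      rw [Finset.sum_image]
      intro a _ b _ hab
      simpa using hab
    rw [this, dg_sum, dg_empty]
    refine Finset.sum_le_sum fun E hE => ?_
    by_cases hE0 : w' E = 0
    · simp [hE0]
    · have : w E ≠ 0 := fun h => hE0 (le_antisymm (h ▸ hw'w E) (hw'0 E))
      have hcard := hwc E this
      obtain ⟨v, hv⟩ : E.Nonempty := Finset.card_pos.1 (by omega)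
      have : (1 : ℝ) ≤ (((V.image (fun v => ({v} : Finset ℕ))).filter (fun T => T ⊆ E)).card : ℝ) := by
        exact_mod_cast Finset.card_pos.2 ⟨{v}, Finset.mem_filter.2
          ⟨Finset.mem_image.2 ⟨v, (Finset.mem_powerset.1 hE) hv, rfl⟩, by simpa using hv⟩⟩
      have := mul_le_mul_of_nonneg_left this (hw'0 E)
      linarith
  obtain ⟨v, hvV, hv⟩ : ∃ v ∈ V, c / 2 * q ≤ dg V w' {v} := by
    by_contra hcon
    push Not at hcon
    have := Finset.sum_lt_sum_of_nonempty hVne hcon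
    rw [Finset.sum_const, nsmul_eq_mul] at this
    linarith
  refine ⟨v, hvV, ?_, hv⟩
  intro hvX
  have : dg V w' {v} = 0 := by
    refine Finset.sum_eq_zero fun E hE => ?_
    rw [Finset.mem_filter, Finset.singleton_subset_iff] at hE
    simp only [hw']
    rw [if_neg]
    rintro ⟨hd, -⟩
    exact Finset.disjoint_left.1 hd hE.2 hvX
  rw [this] at hv
  have : 0 < c / 2 * q := by positivity
  linarith

theorem cl_succ (r : ℕ) (hCL : CL r) : CL (r + 1) := by
  classical
  intro c C hc hC
  set c' : ℝ := c / 4 / 2 ^ r with hc'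
  have hc'0 : 0 < c' := by positivity
  obtain ⟨ε', B', hε', hε'1, hB', H⟩ := hCL c' (2 * C) hc'0 (by positivity)
  set ε : ℝ := min ε' (c / (4 * C)) with hε
  have hε0 : 0 < ε := lt_min hε' (by positivity)
  have hεε' : ε ≤ ε' := min_le_left _ _
  have hεC : ε * C ≤ c / 4 := by
    have : ε ≤ c / (4 * C) := min_le_right _ _
    rw [le_div_iff₀ (by positivity)] at this
    linarith
  refine ⟨ε, B' + (2 * c' / c + 1), hε0, hεε'.trans hε'1, by positivity, ?_⟩
  intro V p q hp hp1 hq w hw0 hwc hsum hdeg F K₀ s M hF hcont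
  set J : ℕ := ⌊2 * c' / c * (p * V.card)⌋₊ + 1 with hJ
  have hJle : (J : ℝ) ≤ 2 * c' / c * (p * V.card) + 1 := by
    rw [hJ]; push_cast
    have := Nat.floor_le (show (0 : ℝ) ≤ 2 * c' / c * (p * V.card) by positivity)
    linarith
  have hpV : 0 ≤ p * (V.card : ℝ) := by positivity
  have hexp : B' * (p * V.card + 1) + J ≤
      (B' + (2 * c' / c + 1)) * (p * V.card + 1) := by
    have e1 : 0 < 2 * c' / c := by positivity
    have e2 : (B' + (2 * c' / c + 1)) * (p * V.card + 1) = B' * (p * V.card + 1) +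
      (2 * c' / c * (p * V.card) + 2 * c' / c + p * V.card + 1) := by ring
    rw [e2]
    linarith
  have hB'V : 0 ≤ B' * (p * V.card + 1) := by positivity
  have main : ∀ (n : ℕ) (X : Finset ℕ) (j : ℕ) (g : Finset ℕ → ℝ) (K : Finset ℕ)
      (F' : Set (Finset ℕ)), (J - j) + (V.card - X.card) < n → X ⊆ V → j ≤ J →
      (K.card : ℝ) ≤ K₀.card + j → F' ⊆ F → (∀ I ∈ F', K ⊆ I ∧ Disjoint I X) →
      (∀ E, 0 ≤ g E) → (∀ E, g E ≠ 0 → E.card = r) →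
      (∀ I ∈ F', ∀ E, E ⊆ I → g E = 0) →
      (∀ T : Finset ℕ, T.Nonempty → dg V g T ≤ 2 * C * p ^ T.card * q) →
      j * (c / 2 * q) ≤ dg V g ∅ → Cov K F' s M := by
    intro n
    induction n with
    | zero => intro X j g K F' h; omega
    | succ n ih =>
      intro X j g K F' hn hXV hj hK hF' hI hg0 hgc hgI hgd hgs
      have hjR : (j : ℝ) ≤ J := by exact_mod_cast hj
      by_cases hX : ε * V.card ≤ X.card
      · -- the removed set is large
        refine hcont F' K hF' ?_ (fun I hII => (hI I hII).1) ⟨V \ X, Finset.sdiff_subset, ?_, ?_⟩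
        · linarith
        · have := Finset.card_sdiff_add_card_eq_card hXV
          have : ((V \ X).card : ℝ) + X.card = V.card := by exact_mod_cast this
          linarith
        · intro I hII v hv
          rw [Finset.mem_sdiff]
          exact ⟨(hF I (hF' hII)).2.1 hv, Finset.disjoint_left.1 (hI I hII).2 hv⟩
      push Not at hX
      by_cases hG : c' * (p * q) * V.card ≤ dg V g ∅
      · refine H V p (p * q) hp hp1 (by positivity) g hg0 hgc hG ?_ F' K s M ?_ ?_
        · intro T hT
          refine (hgd T hT).trans (le_of_eq ?_)
          have : p ^ T.card = p ^ (T.card - 1) * p := by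
            rw [← pow_succ, Nat.sub_add_cancel (Finset.card_pos.2 hT)]
          rw [this]; ring
        · exact fun I hII => ⟨(hI I hII).1, (hF I (hF' hII)).2.1, hgI I hII⟩
        · intro F'' K' hF'' hK' hKI hX'
          obtain ⟨X', h1, h2, h3⟩ := hX'
          refine hcont F'' K' (hF''.trans hF') ?_ hKI ⟨X', h1, h2.trans ?_, h3⟩
          · linarith
          · gcongr
      push Not at hG
      obtain ⟨w', hw'0, hw'w, hsat, v, hvV, hvX, hv⟩ := cl_pick hc hC
        (show c' * 2 ^ r = c / 4 by rw [hc']; field_simp) hεC hp hq hw0 hwc hsum hdeg hX hg0 hgc hG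
      have hjlt : j < J := by
        have h1 : (j : ℝ) * (c / 2 * q) < c' * (p * q) * V.card := lt_of_le_of_lt hgs hG
        have h2 : (j : ℝ) ≤ 2 * c' / c * (p * V.card) := by
          rw [div_mul_eq_mul_div, le_div_iff₀ hc]
          by_contra hcon
          push Not at hcon
          nlinarith
        have := Nat.le_floor h2
        omega
      have hXc : X.card < V.card := by
        refine Finset.card_lt_card ⟨hXV, fun h => hvX (h hvV)⟩
      have hw'0' : ∀ E, w E = 0 → w' E = 0 := fun E h => le_antisymm (h ▸ hw'w E) (hw'0 E)
      have hlk0 : ∀ E, 0 ≤ lk v w' E := by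
        intro E; unfold lk; split_ifs
        · exact le_rfl
        · exact hw'0 _
      refine cov_branch v ?_ ?_
      · refine ih X (j + 1) (fun E => g E + lk v w' E) (insert v K) _ (by omega) hXV hjlt ?_
          (fun I h => hF' h.1) ?_ ?_ ?_ ?_ ?_ ?_
        · have : ((insert v K).card : ℝ) ≤ K.card + 1 := by
            exact_mod_cast Finset.card_insert_le _ _
          push_cast
          linarith
        · intro I h
          exact ⟨Finset.insert_subset h.2 (hI I h.1).1, (hI I h.1).2⟩
        · intro E
          exact add_nonneg (hg0 E) (hlk0 E)
        · intro E hE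
          by_cases h1 : g E = 0
          · have h2 : lk v w' E ≠ 0 := fun h2 => hE (by simp [h1, h2])
            unfold lk at h2
            split_ifs at h2 with h3
            · exact absurd rfl h2
            · have h4 : w (insert v E) ≠ 0 := fun h => h2 (hw'0' _ h)
              have := hwc _ h4
              rw [Finset.card_insert_of_notMem h3] at this
              omega
          · exact hgc E h1
        · intro I h E hE
          have h1 : lk v w' E = 0 := by
            unfold lk
            split_ifs
            · rfl
            · exact hw'0' _ ((hF I (hF' h.1)).2.2 _ (Finset.insert_subset h.2 hE))
          simp only [hgI I h.1 E hE, h1, add_zero]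
        · intro T hT
          rw [dg_add]
          by_cases hvT : v ∈ T
          · rw [dg_lk_of_mem hvT, add_zero]
            exact hgd T hT
          · rw [dg_lk_of_notMem hvV hvT]
            by_cases hTs : C * p ^ T.card * q ≤ dg V g T
            · have : dg V w' (insert v T) = 0 := by
                refine Finset.sum_eq_zero fun E hE => ?_
                rw [Finset.mem_filter, Finset.mem_powerset] at hE
                exact hsat T hT hTs E ((Finset.subset_insert _ _).trans hE.2) hE.1
              rw [this, add_zero]
              exact hgd T hT
            · push Not at hTs
              have h1 := (dg_mono hw'w (insert v T)).trans (hdeg (insert v T) (Finset.insert_nonempty _ _))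
              rw [Finset.card_insert_of_notMem hvT, Nat.add_sub_cancel] at h1
              linarith
        · rw [dg_add, dg_lk_of_notMem hvV (Finset.notMem_empty v)]
          push_cast
          have : (insert v ∅ : Finset ℕ) = {v} := rfl
          rw [this]
          linarith
      · refine ih (insert v X) j g K _ ?_ (Finset.insert_subset hvV hXV) hj hK
          (fun I h => hF' h.1) ?_ hg0 hgc (fun I h => hgI I h.1) hgd hgs
        · rw [Finset.card_insert_of_notMem hvX]; omega
        · intro I h
          refine ⟨(hI I h.1).1, ?_⟩
          rw [Finset.disjoint_insert_right]
          exact ⟨h.2, (hI I h.1).2⟩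
  refine main _ ∅ 0 (fun _ => 0) K₀ F (Nat.lt_succ_self _) (Finset.empty_subset _) (Nat.zero_le _)
    (by simp) subset_rfl (fun I hI => ⟨(hF I hI).1, Finset.disjoint_empty_right _⟩)
    (fun _ => le_rfl) (fun E hE => absurd rfl hE) (fun _ _ _ _ => rfl) ?_ ?_
  · intro T _
    simp only [dg, Finset.sum_const_zero]
    positivity
  · simp [dg]

theorem cl_all (r : ℕ) : CL (r + 1) := by
  induction r with
  | zero => exact cl_one
  | succ r ih => exact cl_succ _ ih

end containerstep

/-! ### Containers for sets without arithmetic progressions -/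

section application

/-- The arithmetic progression as a finset. -/
def apSet (k a d : ℕ) : Finset ℕ := (Finset.range k).image (fun i => a + i * d)

lemma mem_apSet {k a d x : ℕ} : x ∈ apSet k a d ↔ ∃ i < k, a + i * d = x := by
  simp [apSet]

lemma apSet_card {k a d : ℕ} (hd : 0 < d) : (apSet k a d).card = k := by
  rw [apSet, Finset.card_image_of_injective, Finset.card_range]
  intro i j hij
  have : i * d = j * d := by simpa using hij
  exact Nat.eq_of_mul_eq_mul_right hd this

/-- The number of ways in which `E` is an arithmetic progression. -/
def apW (k n : ℕ) (E : Finset ℕ) : ℝ :=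
  (((Finset.Icc 1 n ×ˢ Finset.Icc 1 n).filter (fun q : ℕ × ℕ => apSet k q.1 q.2 = E)).card : ℝ)

lemma dg_apW (k n : ℕ) (V T : Finset ℕ) : dg V (apW k n) T =
    (((Finset.Icc 1 n ×ˢ Finset.Icc 1 n).filter
      (fun q : ℕ × ℕ => apSet k q.1 q.2 ⊆ V ∧ T ⊆ apSet k q.1 q.2)).card : ℝ) := by
  rw [dg]
  unfold apW
  rw [← Nat.cast_sum]
  congr 1
  rw [Finset.card_eq_sum_card_fiberwise (f := fun q : ℕ × ℕ => apSet k q.1 q.2)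
    (t := V.powerset.filter (fun E => T ⊆ E))]
  · refine Finset.sum_congr rfl fun E hE => ?_
    rw [Finset.mem_filter, Finset.mem_powerset] at hE
    rw [Finset.filter_filter]
    congr 1
    refine Finset.filter_congr fun q _ => ?_
    constructor
    · rintro rfl
      exact ⟨hE, rfl⟩
    · exact fun h => h.2
  · intro q hq
    simp only [Finset.coe_filter, Set.mem_setOf_eq, Finset.mem_powerset] at hq ⊢
    exact hq.2

lemma apW_ne {k n : ℕ} {E : Finset ℕ} (h : apW k n E ≠ 0) :
    ∃ a d : ℕ, 0 < a ∧ 0 < d ∧ apSet k a d = E := by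
  have : 0 < ((Finset.Icc 1 n ×ˢ Finset.Icc 1 n).filter
      (fun q : ℕ × ℕ => apSet k q.1 q.2 = E)).card := by
    rw [Nat.pos_iff_ne_zero]
    intro h0
    exact h (by rw [apW, h0, Nat.cast_zero])
  obtain ⟨q, hq⟩ := Finset.card_pos.1 this
  simp only [Finset.mem_filter, Finset.mem_product, Finset.mem_Icc] at hq
  exact ⟨q.1, q.2, by omega, by omega, hq.2⟩

lemma dg_apW_one (k n x : ℕ) (V T : Finset ℕ) (hx : x ∈ T) : dg V (apW k n) T ≤ k * n := by
  rw [dg_apW]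
  have : ((Finset.Icc 1 n ×ˢ Finset.Icc 1 n).filter
      (fun q : ℕ × ℕ => apSet k q.1 q.2 ⊆ V ∧ T ⊆ apSet k q.1 q.2)) ⊆
      (Finset.range k ×ˢ Finset.Icc 1 n).image (fun q : ℕ × ℕ => (x - q.1 * q.2, q.2)) := by
    intro q hq
    simp only [Finset.mem_filter, Finset.mem_product] at hq
    obtain ⟨i, hi, hix⟩ := mem_apSet.1 (hq.2.2 hx)
    rw [Finset.mem_image]
    refine ⟨(i, q.2), ?_, ?_⟩
    · rw [Finset.mem_product, Finset.mem_range]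
      exact ⟨hi, hq.1.2⟩
    · ext
      · simp only; omega
      · rfl
  have := (Finset.card_le_card this).trans Finset.card_image_le
  rw [Finset.card_product, Finset.card_range, Nat.card_Icc, Nat.add_sub_cancel] at this
  exact_mod_cast this

lemma dg_apW_two (k n x y : ℕ) (V T : Finset ℕ) (hx : x ∈ T) (hy : y ∈ T) (hxy : x < y) :
    dg V (apW k n) T ≤ k * k := by
  rw [dg_apW]
  have : ((Finset.Icc 1 n ×ˢ Finset.Icc 1 n).filter
      (fun q : ℕ × ℕ => apSet k q.1 q.2 ⊆ V ∧ T ⊆ apSet k q.1 q.2)) ⊆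
      (Finset.range k ×ˢ Finset.range k).image
        (fun q : ℕ × ℕ => (x - q.1 * ((y - x) / (q.2 - q.1)), (y - x) / (q.2 - q.1))) := by
    intro q hq
    simp only [Finset.mem_filter, Finset.mem_product, Finset.mem_Icc] at hq
    obtain ⟨i, hi, hix⟩ := mem_apSet.1 (hq.2.2 hx)
    obtain ⟨j, hj, hjy⟩ := mem_apSet.1 (hq.2.2 hy)
    have hij : i < j := by
      by_contra hc
      have : j * q.2 ≤ i * q.2 := Nat.mul_le_mul_right _ (by omega)
      omega
    have hd : (y - x) / (j - i) = q.2 := by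
      have : y - x = (j - i) * q.2 := by
        rw [Nat.sub_mul]; omega
      rw [this, Nat.mul_div_cancel_left _ (by omega)]
    rw [Finset.mem_image]
    refine ⟨(i, j), ?_, ?_⟩
    · rw [Finset.mem_product, Finset.mem_range, Finset.mem_range]
      exact ⟨hi, hj⟩
    · ext
      · simp only [hd]; omega
      · simp only [hd]
  have := (Finset.card_le_card this).trans Finset.card_image_le
  rw [Finset.card_product, Finset.card_range] at this
  exact_mod_cast this

/-- Sets without `k`-term arithmetic progressions. -/
def apFree (k : ℕ) (A : Finset ℕ) : Prop := ¬ ∃ a d : ℕ, 0 < a ∧ 0 < d ∧ ∀ i < k, a + i * d ∈ A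

lemma ap_round (k : ℕ) (hk : 3 ≤ k) (β : ℝ) (hβ : 0 < β) (hβ1 : β ≤ 1) :
    ∃ ε B : ℝ, 0 < ε ∧ ε ≤ 1 ∧ 0 < B ∧ ∃ n₁ : ℕ, 1 ≤ n₁ ∧ ∀ n : ℕ, n₁ ≤ n → ∀ X : Finset ℕ,
      X ⊆ Finset.Icc 1 n → β * n ≤ X.card →
      ∀ (F : Set (Finset ℕ)) (K : Finset ℕ) (s M : ℝ),
        (∀ I ∈ F, K ⊆ I ∧ I ⊆ X ∧ apFree k I) →
        (∀ (F' : Set (Finset ℕ)) (K' : Finset ℕ), F' ⊆ F →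
          (K'.card : ℝ) ≤ K.card + B * ((n : ℝ) ^ ((1 : ℝ) - 1 / ((k : ℝ) - 1)) + 1) →
          (∀ I ∈ F', K' ⊆ I) →
          (∃ X' : Finset ℕ, X' ⊆ X ∧ (X'.card : ℝ) ≤ (1 - ε) * X.card ∧ ∀ I ∈ F', I ⊆ X') →
            Cov K' F' s M) →
        Cov K F s M := by
  obtain ⟨c, hc, n₁, hS⟩ := szemeredi_supersat k (by omega) β hβ hβ1
  have hkR : (3 : ℝ) ≤ k := by exact_mod_cast hk
  have hCL : CL k := by
    have := cl_all (k - 1)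
    rwa [Nat.sub_add_cancel (by omega)] at this
  obtain ⟨ε, B, hε, hε1, hB, H⟩ := hCL c (k * k) hc (by positivity)
  refine ⟨ε, B, hε, hε1, hB, max n₁ 1, le_max_right _ _, ?_⟩
  intro n hn X hX hXc F K s M hF hcont
  have hn1 : 1 ≤ n := (le_max_right _ _).trans hn
  have hnR : (1 : ℝ) ≤ n := by exact_mod_cast hn1
  have hn0 : (0 : ℝ) < n := by linarith
  have hXn : (X.card : ℝ) ≤ n := by
    have := Finset.card_le_card hX
    rw [Nat.card_Icc, Nat.add_sub_cancel] at this
    exact_mod_cast this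
  set p : ℝ := (n : ℝ) ^ (-(1 / ((k : ℝ) - 1))) with hp
  have hp0 : 0 < p := Real.rpow_pos_of_pos hn0 _
  have hk1 : 0 < 1 / ((k : ℝ) - 1) := by
    apply one_div_pos.2; linarith
  have hp1 : p ≤ 1 := Real.rpow_le_one_of_one_le_of_nonpos hnR (by linarith)
  have hpk : p ^ (k - 1) * n = 1 := by
    rw [hp, ← Real.rpow_natCast, ← Real.rpow_mul hn0.le, Nat.cast_sub (by omega), Nat.cast_one]
    have : -(1 / ((k : ℝ) - 1)) * ((k : ℝ) - 1) = -1 := by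
      have : (k : ℝ) - 1 ≠ 0 := by linarith
      field_simp
    rw [this, Real.rpow_neg_one, inv_mul_cancel₀ hn0.ne']
  have hpn : p * n = (n : ℝ) ^ ((1 : ℝ) - 1 / ((k : ℝ) - 1)) := by
    rw [hp, sub_eq_add_neg (1 : ℝ), Real.rpow_add hn0, Real.rpow_one, mul_comm]
  refine H X p n hp0 hp1 hn0 (apW k n) (fun E => Nat.cast_nonneg _) ?_ ?_ ?_ F K s M ?_ ?_
  · intro E hE
    obtain ⟨a, d, -, hd, rfl⟩ := apW_ne hE
    exact apSet_card hd
  · have h1 := hS n ((le_max_left _ _).trans hn) X hX hXc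
    have h2 : c * n * X.card ≤ c * (n : ℝ) ^ 2 := by
      rw [pow_two, ← mul_assoc]; gcongr
    refine h2.trans (h1.trans ?_)
    rw [dg_apW]
    gcongr
    intro h
    refine ⟨fun x hx => ?_, Finset.empty_subset _⟩
    obtain ⟨i, hi, rfl⟩ := mem_apSet.1 hx
    exact h i hi
  · intro T hT
    by_cases hTk : k < T.card
    · have : dg X (apW k n) T = 0 := by
        refine Finset.sum_eq_zero fun E hE => ?_
        by_contra hne
        obtain ⟨a, d, -, hd, rfl⟩ := apW_ne hne
        have h1 := Finset.card_le_card (Finset.mem_filter.1 hE).2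
        rw [apSet_card hd] at h1
        omega
      rw [this]; positivity
    push Not at hTk
    by_cases hT1 : T.card = 1
    · obtain ⟨x, hx⟩ := hT
      refine (dg_apW_one k n x X T hx).trans ?_
      rw [hT1]
      simp only [Nat.sub_self, pow_zero, mul_one]
      have h0 : (k : ℝ) ≤ k * k := by nlinarith
      exact mul_le_mul_of_nonneg_right h0 hn0.le
    · have hT2 : 1 < T.card := by
        have := Finset.card_pos.2 hT
        omega
      have key : dg X (apW k n) T ≤ k * k := by
        obtain ⟨x, hx, y, hy, hxy⟩ := Finset.one_lt_card.1 hT2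
        rcases lt_or_gt_of_ne hxy with h | h
        · exact dg_apW_two k n x y X T hx hy h
        · exact dg_apW_two k n y x X T hy hx h
      have h2 : p ^ (k - 1) ≤ p ^ (T.card - 1) :=
        pow_le_pow_of_le_one hp0.le hp1 (by omega)
      calc dg X (apW k n) T ≤ k * k := key
        _ = k * k * (p ^ (k - 1) * n) := by rw [hpk, mul_one]
        _ ≤ k * k * (p ^ (T.card - 1) * n) := by gcongr
        _ = _ := by ring
  · intro I hI
    refine ⟨(hF I hI).1, (hF I hI).2.1, fun E hE => ?_⟩
    by_contra hne
    obtain ⟨a, d, ha, hd, rfl⟩ := apW_ne hne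
    exact (hF I hI).2.2 ⟨a, d, ha, hd, fun i hi => hE (mem_apSet.2 ⟨i, hi, rfl⟩)⟩
  · intro F' K' hF' hK' hKI hX'
    refine hcont F' K' hF' (hK'.trans ?_) hKI hX'
    rw [← hpn]
    gcongr

theorem ap_containers (k : ℕ) (hk : 3 ≤ k) (β : ℝ) (hβ : 0 < β) (hβ1 : β ≤ 1) :
    ∃ C : ℝ, 0 < C ∧ ∃ n₁ : ℕ, 1 ≤ n₁ ∧ ∀ n : ℕ, n₁ ≤ n →
      Cov ∅ {I | I ⊆ Finset.Icc 1 n ∧ apFree k I}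
        (C * (n : ℝ) ^ ((1 : ℝ) - 1 / ((k : ℝ) - 1))) (β * n) := by
  obtain ⟨ε, B, hε, hε1, hB, n₁, hn₁, H⟩ := ap_round k hk β hβ hβ1
  obtain ⟨R, hR⟩ := exists_pow_lt_of_lt_one hβ (show 1 - ε < 1 by linarith)
  refine ⟨R * B * 2 + 1, by positivity, n₁, hn₁, fun n hn => ?_⟩
  have hnR : (1 : ℝ) ≤ n := by exact_mod_cast hn₁.trans hn
  have hkR : (3 : ℝ) ≤ k := by exact_mod_cast hk
  set P : ℝ := (n : ℝ) ^ ((1 : ℝ) - 1 / ((k : ℝ) - 1)) with hP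
  have hP1 : 1 ≤ P := by
    refine Real.one_le_rpow hnR ?_
    rw [sub_nonneg, div_le_one (by linarith)]
    linarith
  have main : ∀ (t : ℕ) (X K : Finset ℕ) (F : Set (Finset ℕ)) (s : ℝ), X ⊆ Finset.Icc 1 n →
      (∀ I ∈ F, K ⊆ I ∧ I ⊆ X ∧ apFree k I) → K.card + t * (B * (P + 1)) ≤ s →
      X.card * (1 - ε) ^ t ≤ β * n → Cov K F s (β * n) := by
    have base : ∀ (X K : Finset ℕ) (F : Set (Finset ℕ)) (s : ℝ),
      (∀ I ∈ F, K ⊆ I ∧ I ⊆ X ∧ apFree k I) → K.card ≤ s →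
      X.card ≤ β * n → Cov K F s (β * n) := by
      intro X K F s hF hK hX
      exact ⟨fun _ => X, fun _ => hX, fun I hI =>
        ⟨K, subset_rfl, (hF I hI).1, hK, (hF I hI).2.1⟩⟩
    intro t
    induction t with
    | zero =>
      intro X K F s _ hF hK hX
      exact base X K F s hF (by simpa using hK) (by simpa using hX)
    | succ t ih =>
      intro X K F s hXn hF hK hX
      have hBP : 0 < B * (P + 1) := by positivity
      push_cast at hK
      by_cases hXs : (X.card : ℝ) ≤ β * n
      · refine base X K F s hF (le_trans ?_ hK) hXs
        have : 0 ≤ ((t : ℝ) + 1) * (B * (P + 1)) := by positivity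
        linarith
      · push Not at hXs
        refine H n hn X hXn hXs.le F K s _ hF ?_
        rintro F' K' hF' hK' hKI ⟨X', hX'X, hX'c, hX'I⟩
        refine ih X' K' F' s (hX'X.trans hXn)
          (fun I hI => ⟨hKI I hI, hX'I I hI, (hF I (hF' hI)).2.2⟩) ?_ ?_
        · linarith
        · refine le_trans ?_ hX
          rw [pow_succ', ← mul_assoc]
          have : 0 ≤ 1 - ε := by linarith
          gcongr
          linarith
  refine main R (Finset.Icc 1 n) ∅ _ _ subset_rfl (fun I hI => ⟨Finset.empty_subset _, hI.1, hI.2⟩) ?_ ?_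
  · simp only [Finset.card_empty, Nat.cast_zero, zero_add]
    have : 0 ≤ (R : ℝ) * B * (P - 1) := mul_nonneg (by positivity) (by linarith)
    nlinarith
  · rw [Nat.card_Icc, Nat.add_sub_cancel, mul_comm]
    gcongr

end application

/-! ### Counting -/

section counting

lemma choose_shrink {b' b : ℕ} {t : ℝ} (ht0 : 0 ≤ t) (ht1 : t ≤ 1) (h : (b' : ℝ) ≤ t * b) (j : ℕ) :
    (Nat.choose b' j : ℝ) ≤ t ^ j * Nat.choose b j := by
  induction j with
  | zero => simp
  | succ j ih =>
    by_cases hj : b' ≤ j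
    · rw [Nat.choose_eq_zero_of_lt (by omega)]
      rw [Nat.cast_zero]
      positivity
    · push Not at hj
      have hb : b' ≤ b := by
        have : (b' : ℝ) ≤ b := h.trans (mul_le_of_le_one_left (Nat.cast_nonneg _) ht1)
        exact_mod_cast this
      have e1 : (Nat.choose b' (j + 1) : ℝ) * (j + 1) = Nat.choose b' j * ((b' : ℝ) - j) := by
        rw [← Nat.cast_sub hj.le]
        exact_mod_cast Nat.choose_succ_right_eq b' j
      have e2 : (Nat.choose b (j + 1) : ℝ) * (j + 1) = Nat.choose b j * ((b : ℝ) - j) := by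
        rw [← Nat.cast_sub (hj.le.trans hb)]
        exact_mod_cast Nat.choose_succ_right_eq b j
      have hj0 : (0 : ℝ) < (j : ℝ) + 1 := by positivity
      refine le_of_mul_le_mul_right ?_ hj0
      rw [e1, mul_assoc, e2]
      have h1 : 0 ≤ (b' : ℝ) - j := by
        have : (j : ℝ) ≤ b' := by exact_mod_cast hj.le
        linarith
      have h2 : (b' : ℝ) - j ≤ t * ((b : ℝ) - j) := by
        have : t * j ≤ j := mul_le_of_le_one_left (Nat.cast_nonneg _) ht1
        linarith
      calc (Nat.choose b' j : ℝ) * ((b' : ℝ) - j) ≤ (t ^ j * Nat.choose b j) * (t * ((b : ℝ) - j)) :=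
            mul_le_mul ih h2 h1 (by positivity)
        _ = _ := by ring

lemma choose_grow {n n' : ℕ} {Q D : ℝ} (hQ : 0 ≤ Q) (h : (n : ℝ) ≤ Q * D) (hD : 0 ≤ D) (s : ℕ)
    (hs : s + D ≤ n') : (Nat.choose n s : ℝ) ≤ Q ^ s * Nat.choose n' s := by
  induction s with
  | zero => simp
  | succ s ih =>
    push_cast at hs
    have ih := ih (by linarith)
    have hsn' : s ≤ n' := by
      have : (s : ℝ) ≤ n' := by linarith
      exact_mod_cast this
    have e1 : (Nat.choose n (s + 1) : ℝ) * (s + 1) ≤ Nat.choose n s * n := by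
      have := Nat.choose_succ_right_eq n s
      have h2 : n.choose (s + 1) * (s + 1) ≤ n.choose s * n := by
        rw [this]; exact Nat.mul_le_mul_left _ (Nat.sub_le _ _)
      exact_mod_cast h2
    have e2 : (Nat.choose n' (s + 1) : ℝ) * (s + 1) = Nat.choose n' s * ((n' : ℝ) - s) := by
      rw [← Nat.cast_sub hsn']
      exact_mod_cast Nat.choose_succ_right_eq n' s
    have hj0 : (0 : ℝ) < (s : ℝ) + 1 := by positivity
    refine le_of_mul_le_mul_right ?_ hj0
    rw [mul_assoc, e2]
    have h2 : (n : ℝ) ≤ Q * ((n' : ℝ) - s) := h.trans (by gcongr; linarith)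
    calc _ ≤ _ := e1
      _ ≤ (Q ^ s * Nat.choose n' s) * (Q * ((n' : ℝ) - s)) :=
          mul_le_mul ih h2 (Nat.cast_nonneg _) (by positivity)
      _ = _ := by ring

lemma term_bound {β : ℝ} (hβ : 0 < β) (hβ1 : β ≤ 1) {n b b' m s : ℕ}
    (hb' : (b' : ℝ) ≤ β / 64 * b) (hb : β * n / 2 ≤ b) (hs : 2 * s ≤ m) :
    (n.choose s : ℝ) * (b'.choose (m - s) : ℝ) * 2 ^ m ≤ b.choose m := by
  by_cases hz : b' < m - s
  · rw [Nat.choose_eq_zero_of_lt hz]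
    simp
  push Not at hz
  obtain ⟨j, hj⟩ : ∃ j, m = s + j := ⟨m - s, by omega⟩
  have hmj : m - s = j := by omega
  rw [hmj] at hz ⊢
  have hjR : (j : ℝ) ≤ b' := by exact_mod_cast hz
  have hb0 : (0 : ℝ) ≤ b := Nat.cast_nonneg _
  have hmR : (m : ℝ) ≤ b / 2 := by
    have : (m : ℝ) ≤ 2 * j := by exact_mod_cast (show m ≤ 2 * j by omega)
    nlinarith
  have hmb : m ≤ b := by
    have : (m : ℝ) ≤ b := by linarith
    exact_mod_cast this
  have h1 := choose_shrink (j := j) (show 0 ≤ β / 64 by positivity) (by linarith) hb'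
  have h2 : (n.choose s : ℝ) ≤ (4 / β) ^ s * ((b - j).choose s : ℝ) := by
    refine choose_grow (D := (b : ℝ) - m) (by positivity) ?_ (by linarith) s ?_
    · rw [div_mul_eq_mul_div, le_div_iff₀ hβ]
      linarith
    · rw [Nat.cast_sub (by omega), hj]
      push_cast
      linarith
  have h3 : b.choose m * m.choose j = b.choose j * (b - j).choose s := by
    have := Nat.choose_mul (n := b) (k := m) (s := j) (by omega)
    rw [this]
    congr 2
    omega
  have h3R : (b.choose m : ℝ) * m.choose j = b.choose j * (b - j).choose s := by exact_mod_cast h3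
  have h4 : (m.choose j : ℝ) ≤ 2 ^ m := by exact_mod_cast Nat.choose_le_two_pow m j
  have hQ : 1 ≤ 4 / β := by rw [le_div_iff₀ hβ]; linarith
  have h5 : (4 / β) ^ s ≤ (4 / β) ^ j := pow_le_pow_right₀ hQ (by omega)
  have h6 : (2 : ℝ) ^ m ≤ 4 ^ j := by
    have : (4 : ℝ) = 2 ^ 2 := by norm_num
    rw [this, ← pow_mul]
    exact pow_le_pow_right₀ (by norm_num) (by omega)
  calc (n.choose s : ℝ) * (b'.choose j : ℝ) * 2 ^ m
      ≤ ((4 / β) ^ s * ((b - j).choose s : ℝ)) * ((β / 64) ^ j * b.choose j) * 2 ^ m := by gcongr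
    _ = ((4 / β) ^ s * (β / 64) ^ j * 2 ^ m) * (b.choose j * (b - j).choose s) := by ring
    _ = ((4 / β) ^ s * (β / 64) ^ j * 2 ^ m) * (b.choose m * m.choose j) := by rw [h3R]
    _ ≤ ((4 / β) ^ j * (β / 64) ^ j * 4 ^ j) * (b.choose m * 4 ^ j) := by
        gcongr
        exact h4.trans h6
    _ = ((4 / β) * (β / 64) * 4 * 4) ^ j * b.choose m := by
        rw [mul_pow, mul_pow, mul_pow]; ring
    _ = b.choose m := by
        have : (4 / β) * (β / 64) * 4 * 4 = 1 := by field_simp; norm_num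
        rw [this, one_pow, one_mul]

open Classical in
lemma count_of_cov {n m s₀ b' : ℕ} {k : ℕ} {s M : ℝ}
    (h : Cov ∅ {I | I ⊆ Finset.Icc 1 n ∧ apFree k I} s M) (hs : s < s₀ + 1)
    (hM : M < b' + 1) :
    (((Finset.Icc 1 n).powersetCard m).filter (apFree k)).card ≤
      ∑ t ∈ Finset.range (s₀ + 1), n.choose t * b'.choose (m - t) := by
  obtain ⟨f, hf, hf'⟩ := h
  have hsub : ((Finset.Icc 1 n).powersetCard m).filter (apFree k) ⊆
      (Finset.range (s₀ + 1)).biUnion fun t => ((Finset.Icc 1 n).powersetCard t).biUnion fun S =>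
        ((f S).powersetCard (m - t)).image (fun A => S ∪ A) := by
    intro I hI
    rw [Finset.mem_filter, Finset.mem_powersetCard] at hI
    obtain ⟨S, -, hSI, hSc, hIS⟩ := hf' I ⟨hI.1.1, hI.2⟩
    rw [Finset.mem_biUnion]
    refine ⟨S.card, ?_, ?_⟩
    · rw [Finset.mem_range]
      have : (S.card : ℝ) < s₀ + 1 := by linarith
      exact_mod_cast this
    · rw [Finset.mem_biUnion]
      refine ⟨S, Finset.mem_powersetCard.2 ⟨hSI.trans hI.1.1, rfl⟩, ?_⟩
      rw [Finset.mem_image]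
      refine ⟨I \ S, Finset.mem_powersetCard.2 ⟨Finset.sdiff_subset.trans hIS, ?_⟩,
        Finset.union_sdiff_of_subset hSI⟩
      rw [Finset.card_sdiff_of_subset hSI, hI.1.2]
  refine (Finset.card_le_card hsub).trans (Finset.card_biUnion_le.trans ?_)
  refine Finset.sum_le_sum fun t _ => ?_
  refine Finset.card_biUnion_le.trans ?_
  refine (Finset.sum_le_card_nsmul _ _ (b'.choose (m - t)) fun S _ => ?_).trans ?_
  · refine Finset.card_image_le.trans ?_
    rw [Finset.card_powersetCard]
    refine Nat.choose_le_choose _ ?_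
    have : ((f S).card : ℝ) < b' + 1 := lt_of_le_of_lt (hf S) hM
    exact Nat.lt_succ_iff.1 (by exact_mod_cast this)
  · rw [Finset.card_powersetCard, Nat.card_Icc, Nat.add_sub_cancel, smul_eq_mul]

open Classical in
lemma count_aux (β : ℝ) (hβ : 0 < β) (hβ1 : β ≤ 1) (k : ℕ) (hk : 3 ≤ k) :
    ∃ (C : ℝ) (n₀ : ℕ), ∀ n : ℕ, n₀ ≤ n → ∀ m : ℕ,
      C * (n : ℝ) ^ ((1 : ℝ) - 1 / ((k : ℝ) - 1)) ≤ (m : ℝ) →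
      (((Finset.Icc 1 n).powersetCard m).filter (apFree k)).card
        ≤ Nat.choose ⌊β * (n : ℝ)⌋₊ m := by
  obtain ⟨C, hC, n₁, hn₁, H⟩ := ap_containers k hk (β / 128 * β) (by positivity) (by nlinarith)
  refine ⟨2 * C, max n₁ ⌈2 / β⌉₊, fun n hn m hm => ?_⟩
  have hn2 : 2 ≤ β * n := by
    have : 2 / β ≤ n := (Nat.le_ceil _).trans (by exact_mod_cast (le_max_right _ _).trans hn)
    rw [div_le_iff₀ hβ] at this
    linarith
  set P : ℝ := (n : ℝ) ^ ((1 : ℝ) - 1 / ((k : ℝ) - 1)) with hP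
  have hP0 : 0 ≤ P := by positivity
  set b := ⌊β * (n : ℝ)⌋₊ with hb
  set b' := ⌊β / 128 * β * (n : ℝ)⌋₊ with hb'
  set s₀ := ⌊C * P⌋₊ with hs₀
  have hcount := count_of_cov (m := m) (H n ((le_max_left _ _).trans hn))
    (Nat.lt_floor_add_one (C * P)) (Nat.lt_floor_add_one (β / 128 * β * (n : ℝ)))
  refine hcount.trans ?_
  have hbge : β * n / 2 ≤ b := by
    have := Nat.lt_floor_add_one (β * (n : ℝ))
    rw [← hb] at this
    linarith
  have hb'le : (b' : ℝ) ≤ β / 64 * b := by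
    have h1 : (b' : ℝ) ≤ β / 128 * β * n := Nat.floor_le (by positivity)
    have h2 : β / 64 * (β * n / 2) ≤ β / 64 * b := by gcongr
    linarith
  have hs₀m : 2 * s₀ ≤ m := by
    have : (s₀ : ℝ) ≤ C * P := Nat.floor_le (by positivity)
    have h2 : (2 : ℝ) * s₀ ≤ m := by linarith
    exact_mod_cast h2
  have h2m : s₀ + 1 ≤ 2 ^ m := by
    have : m < 2 ^ m := Nat.lt_two_pow_self
    omega
  have hsum : (∑ t ∈ Finset.range (s₀ + 1), n.choose t * b'.choose (m - t)) * 2 ^ m ≤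
      2 ^ m * b.choose m := by
    rw [Finset.sum_mul]
    refine (Finset.sum_le_card_nsmul _ _ (b.choose m) fun t ht => ?_).trans ?_
    · rw [Finset.mem_range] at ht
      have := term_bound hβ hβ1 (n := n) (m := m) (s := t) hb'le hbge (by omega)
      exact_mod_cast this
    · rw [Finset.card_range, smul_eq_mul]
      exact Nat.mul_le_mul_right _ h2m
  rw [mul_comm] at hsum
  exact Nat.le_of_mul_le_mul_left hsum (by positivity)

end counting

attribute [local instance] Classical.propDecidable

/-- Theorem 1.1: counting `m`-subsets of `{1, …, n}` with no `k`-term arithmetic progression. -/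
theorem count_sets_no_kAP (β : ℝ) (hβ : 0 < β) (k : ℕ) (hk : 3 ≤ k) :
    ∃ (C : ℝ) (n₀ : ℕ), ∀ n : ℕ, n₀ ≤ n → ∀ m : ℕ,
      C * (n : ℝ) ^ ((1 : ℝ) - 1 / ((k : ℝ) - 1)) ≤ (m : ℝ) →
      (((Finset.Icc 1 n).powersetCard m).filter
          (fun A : Finset ℕ =>
            ¬ ∃ a d : ℕ, 0 < a ∧ 0 < d ∧ ∀ i < k, a + i * d ∈ A)).card
        ≤ Nat.choose ⌊β * (n : ℝ)⌋₊ m := by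
  obtain ⟨C, n₀, H⟩ := count_aux (min β 1) (lt_min hβ one_pos) (min_le_right _ _) k hk
  refine ⟨C, n₀, fun n hn m hm => ?_⟩
  refine le_trans (le_of_eq ?_) ((H n hn m hm).trans (Nat.choose_le_choose _ (Nat.floor_le_floor ?_)))
  · congr 1
    refine Finset.filter_congr fun A _ => ?_
    rfl
  · gcongr
    exact min_le_left _ _
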